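/- There exists R₀ > 0 (depending only on f and N) such that for every R ≥ R₀, every α ∈ (0, π/2) and every funnel-shaped domain Ω = Ω_{R,α}, the unique entire solution u emanating from the planar front propagates completely, i.e. u(t,x) → 1 as t → +∞ locally uniformly in x ∈ Ω̄. -/

import Mathlib

open Set Filter Topology MeasureTheory

noncomputable section

/-- `ℝ^N` with `N = d+1`, Euclidean structure. -/
abbrev Euc (d : ℕ) := EuclideanSpace ℝ (Fin (d + 1))

/-- The Euclidean norm of `x' = (x₂,…,x_N)` for `x = (x₁,x') ∈ ℝ^N`. -/
def primeNorm {d : ℕ} (x : Euc d) : ℝ :=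
  Real.sqrt (∑ i, if i = 0 then 0 else (x i) ^ 2)

/-- The funnel-shaped domain `Ω = {x : |x'| < h(x₁)}`. -/
def funnel (d : ℕ) (h : ℝ → ℝ) : Set (Euc d) := {x | primeNorm x < h (x 0)}

/-- The Laplacian of `g` at `x`, computed with derivatives taken within the set `s`. -/
def lapW {d : ℕ} (s : Set (Euc d)) (g : Euc d → ℝ) (x : Euc d) : ℝ :=
  ∑ i, fderivWithin ℝ (fun y => fderivWithin ℝ g s y (EuclideanSpace.single i 1)) s x
      (EuclideanSpace.single i 1)

/-- The quantity `ν·∇g` at a boundary point `x` of the funnel domain `Ω_{R,α}`, where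
`ν(x) = (1+h'(x₁)²)^{-1/2}·(-h'(x₁), x'/|x'|)` is the outward unit normal. -/
def neumannLHS {d : ℕ} (h : ℝ → ℝ) (g : Euc d → ℝ) (x : Euc d) : ℝ :=
  (Real.sqrt (1 + deriv h (x 0) ^ 2))⁻¹ *
    (-(deriv h (x 0)) * fderivWithin ℝ g (closure (funnel d h)) x (EuclideanSpace.single 0 1)
      + ∑ i, if i = 0 then 0 else
          (x i / primeNorm x) *
            fderivWithin ℝ g (closure (funnel d h)) x (EuclideanSpace.single i 1))

/-- The bistable nonlinearity `f`, of class `C^{1,1}`, with positive mass, extended affinely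
outside `[0,1]`. -/
structure Bistable (f : ℝ → ℝ) (θ : ℝ) : Prop where
  smooth : ContDiff ℝ 1 f
  lip_deriv : ∃ C : NNReal, LipschitzWith C (deriv f)
  f0 : f 0 = 0
  f1 : f 1 = 0
  df0 : deriv f 0 < 0
  df1 : deriv f 1 < 0
  θmem : θ ∈ Ioo (0 : ℝ) 1
  neg : ∀ s ∈ Ioo (0 : ℝ) θ, f s < 0
  pos : ∀ s ∈ Ioo θ (1 : ℝ), 0 < f s
  dθ : 0 < deriv f θ
  mass : 0 < ∫ s in (0 : ℝ)..1, f s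
  ext_neg : ∀ s < (0 : ℝ), f s = deriv f 0 * s
  ext_pos : ∀ s > (1 : ℝ), f s = deriv f 1 * (s - 1)

/-- The planar traveling front `φ(x₁ - ct)`: `φ'' + cφ' + f(φ) = 0`, `φ(-∞) = 1`,
`φ(+∞) = 0`, `0 < φ < 1`, `φ` decreasing, normalized by `φ(0) = θ`, with speed `c > 0`. -/
structure PlanarFront (f : ℝ → ℝ) (θ c : ℝ) (φ : ℝ → ℝ) : Prop where
  cpos : 0 < c
  mem : ∀ z : ℝ, φ z ∈ Ioo (0 : ℝ) 1
  smooth : ContDiff ℝ 2 φ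
  anti : StrictAnti φ
  ode : ∀ z : ℝ, deriv (deriv φ) z + c * deriv φ z + f (φ z) = 0
  lim_bot : Tendsto φ atBot (nhds 1)
  lim_top : Tendsto φ atTop (nhds 0)
  pin : φ 0 = θ

/-- `h : ℝ → ℝ` defines a funnel-shaped domain `Ω_{R,α}` (of dimension `N = d+1 ≥ 2`) with
cylinder radius `R`, opening angle `α` and transition parameter `L`. -/
structure IsFunnel (d : ℕ) (R α L : ℝ) (h : ℝ → ℝ) : Prop where
  dpos : 1 ≤ d
  Rpos : 0 < R
  αmem : α ∈ Ico (0 : ℝ) (Real.pi / 2)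
  RL : R < L
  smooth : ContDiff ℝ 2 h
  holder : ∃ β : NNReal, 0 < β ∧ (β : ℝ) < 1 ∧ ∃ C : NNReal, HolderWith C β (deriv (deriv h))
  deriv_nonneg : ∀ x : ℝ, 0 ≤ deriv h x
  deriv_le : ∀ x : ℝ, deriv h x ≤ Real.tan α
  left : ∀ x ≤ (0 : ℝ), h x = R
  right : ∀ x : ℝ, L * Real.cos α ≤ x → h x = x * Real.tan α

/-- An entire solution of `u_t = Δu + f(u)` in `ℝ × Ω̄` (with values in `[0,1]`),
Neumann boundary condition `ν·∇u = 0` on `ℝ × ∂Ω`, emanating from the planar front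
`φ(x₁ - ct)` as `t → -∞`. -/
structure IsEntireSolution (d : ℕ) (h f : ℝ → ℝ) (c : ℝ) (φ : ℝ → ℝ)
    (u : ℝ → Euc d → ℝ) : Prop where
  range01 : ∀ t : ℝ, ∀ x ∈ closure (funnel d h), u t x ∈ Icc (0 : ℝ) 1
  time_diff : ∀ x ∈ closure (funnel d h), Differentiable ℝ fun t => u t x
  space_reg : ∀ t : ℝ, ContDiffOn ℝ 2 (u t) (closure (funnel d h))
  pde : ∀ t : ℝ, ∀ x ∈ closure (funnel d h),
      deriv (fun s => u s x) t = lapW (closure (funnel d h)) (u t) x + f (u t x)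
  neumann : ∀ t : ℝ, ∀ x ∈ frontier (funnel d h), neumannLHS h (u t) x = 0
  past : ∀ ε > (0 : ℝ), ∃ T : ℝ, ∀ t ≤ T, ∀ x ∈ closure (funnel d h),
      |u t x - φ (x 0 - c * t)| ≤ ε

/-- Complete propagation: `u(t,x) → 1` as `t → +∞` locally uniformly in `x ∈ Ω̄`. -/
def CompletePropagation (d : ℕ) (h : ℝ → ℝ) (u : ℝ → Euc d → ℝ) : Prop :=
  TendstoLocallyUniformlyOn u (fun _ => (1 : ℝ)) atTop (closure (funnel d h))

/-- Blocking: `u(t,·)` converges uniformly on `Ω̄`, as `t → +∞`, to a stationary solution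
`u_∞` with `u_∞(x) → 0` as `x₁ → +∞`. -/
def Blocked (d : ℕ) (h f : ℝ → ℝ) (u : ℝ → Euc d → ℝ) : Prop :=
  ∃ uinf : Euc d → ℝ,
    TendstoUniformlyOn u uinf atTop (closure (funnel d h)) ∧
    ContDiffOn ℝ 2 uinf (closure (funnel d h)) ∧
    (∀ x ∈ closure (funnel d h), lapW (closure (funnel d h)) uinf x + f (uinf x) = 0) ∧
    (∀ x ∈ frontier (funnel d h), neumannLHS h uinf x = 0) ∧
    (∀ ε > (0 : ℝ), ∃ A : ℝ, ∀ x ∈ closure (funnel d h), A ≤ x 0 → |uinf x| ≤ ε)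

/-- Stability of a solution `U` of `ΔU + f(U) = 0` on `s̄`:
`∫_s (|∇ψ|² - f'(U)ψ²) ≥ 0` for all compactly supported `C¹` functions `ψ`. -/
def StableOn {d : ℕ} (s : Set (Euc d)) (f : ℝ → ℝ) (U : Euc d → ℝ) : Prop :=
  ∀ ψ : Euc d → ℝ, ContDiff ℝ 1 ψ → HasCompactSupport ψ →
    0 ≤ ∫ x in s, (‖gradient ψ x‖ ^ 2 - deriv f (U x) * ψ x ^ 2)

/-! ### Geometry of the funnel -/

/-- The square of the Euclidean norm of `x'`. -/
def primeSq {d : ℕ} (x : Euc d) : ℝ := ∑ i, if i = 0 then 0 else (x i) ^ 2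

lemma primeSq_nonneg {d : ℕ} (x : Euc d) : 0 ≤ primeSq x :=
  Finset.sum_nonneg fun i _ => by split_ifs <;> positivity

lemma primeNorm_sq {d : ℕ} (x : Euc d) : primeNorm x ^ 2 = primeSq x :=
  Real.sq_sqrt (primeSq_nonneg x)

lemma primeNorm_nonneg {d : ℕ} (x : Euc d) : 0 ≤ primeNorm x := Real.sqrt_nonneg _

/-- The projection `x ↦ (0, x')`. -/
def primeProj (d : ℕ) : Euc d →L[ℝ] Euc d :=
  ContinuousLinearMap.id ℝ (Euc d) -
    (EuclideanSpace.proj (0 : Fin (d + 1)) : Euc d →L[ℝ] ℝ).smulRight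
      (EuclideanSpace.single (0 : Fin (d + 1)) (1 : ℝ))

lemma primeProj_apply {d : ℕ} (x : Euc d) (i : Fin (d + 1)) :
    primeProj d x i = if i = 0 then 0 else x i := by
  by_cases hi : i = 0
  · subst hi; simp [primeProj]
  · simp [primeProj, hi]

lemma primeNorm_eq_norm {d : ℕ} (x : Euc d) : primeNorm x = ‖primeProj d x‖ := by
  rw [EuclideanSpace.norm_eq, primeNorm]
  congr 1
  refine Finset.sum_congr rfl fun i _ => ?_
  rw [primeProj_apply]
  split_ifs <;> simp

lemma continuous_primeNorm {d : ℕ} : Continuous (primeNorm : Euc d → ℝ) := by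
  have : (primeNorm : Euc d → ℝ) = fun x => ‖primeProj d x‖ := funext primeNorm_eq_norm
  rw [this]
  fun_prop

lemma norm_sq_eq_add_primeSq {d : ℕ} (x : Euc d) : ‖x‖ ^ 2 = x 0 ^ 2 + primeSq x := by
  rw [EuclideanSpace.norm_sq_eq, primeSq, Fin.sum_univ_succ, Fin.sum_univ_succ]
  simp [Fin.succ_ne_zero]

lemma primeNorm_le_norm {d : ℕ} (x : Euc d) : primeNorm x ≤ ‖x‖ := by
  apply le_of_sq_le_sq _ (norm_nonneg _)
  rw [norm_sq_eq_add_primeSq, primeNorm_sq]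
  nlinarith [sq_nonneg (x 0)]

lemma abs_apply_zero_le_norm {d : ℕ} (x : Euc d) : |x 0| ≤ ‖x‖ := by
  apply abs_le_of_sq_le_sq _ (norm_nonneg _)
  rw [norm_sq_eq_add_primeSq]
  nlinarith [primeSq_nonneg x]

/-- The point `(a, 0)` of the axis. -/
def axisPt (d : ℕ) (a : ℝ) : Euc d := EuclideanSpace.single 0 a

lemma axisPt_apply {d : ℕ} (a : ℝ) (i : Fin (d + 1)) :
    axisPt d a i = if i = 0 then a else 0 := by
  simp [axisPt]

lemma primeNorm_sub_axisPt {d : ℕ} (x : Euc d) (a : ℝ) :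
    primeNorm (x - axisPt d a) = primeNorm x := by
  unfold primeNorm
  congr 1
  refine Finset.sum_congr rfl fun i _ => ?_
  split_ifs with hi
  · rfl
  · simp [axisPt_apply, hi]

lemma convex_halfCylinder {d : ℕ} {a r : ℝ} (hr : 0 < r) :
    Convex ℝ {y : Euc d | a ≤ y 0 ∧ primeNorm y ≤ r} ∧
      (interior {y : Euc d | a ≤ y 0 ∧ primeNorm y ≤ r}).Nonempty := by
  have h2 : Continuous (primeNorm : Euc d → ℝ) := continuous_primeNorm
  constructor
  · have e : {y : Euc d | a ≤ y 0 ∧ primeNorm y ≤ r} =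
        (EuclideanSpace.proj (0 : Fin (d + 1)) : Euc d →L[ℝ] ℝ) ⁻¹' Ici a ∩
          primeProj d ⁻¹' Metric.closedBall 0 r := by
      ext y; simp [primeNorm_eq_norm]
    rw [e]
    exact ((convex_Ici a).linear_preimage
        (EuclideanSpace.proj (0 : Fin (d + 1)) : Euc d →L[ℝ] ℝ).toLinearMap).inter
      ((convex_closedBall _ _).linear_preimage (primeProj d).toLinearMap)
  · refine ⟨axisPt d (a + 1), ?_⟩
    refine interior_maximal (s := {y : Euc d | a ≤ y 0 ∧ primeNorm y ≤ r})
      (t := {y : Euc d | a < y 0 ∧ primeNorm y < r})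
      (fun y hy => ⟨hy.1.le, hy.2.le⟩) ?_ ?_
    · have o1 : IsOpen {y : Euc d | a < y 0} := isOpen_lt continuous_const (by fun_prop)
      have o2 : IsOpen {y : Euc d | primeNorm y < r} := isOpen_lt h2 continuous_const
      exact o1.inter o2
    · refine ⟨by simp [axisPt_apply], ?_⟩
      have := primeNorm_sub_axisPt (axisPt d (a + 1)) (a + 1)
      rw [sub_self] at this
      rw [← this, primeNorm_eq_norm]
      simpa using hr

/-- A defining function of the funnel: positive inside, zero on the boundary. -/
def levelFn {d : ℕ} (h : ℝ → ℝ) (x : Euc d) : ℝ := h (x 0) ^ 2 - primeSq x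

namespace IsFunnel

variable {d : ℕ} {R α L : ℝ} {h : ℝ → ℝ}

lemma differentiable (hh : IsFunnel d R α L h) : Differentiable ℝ h :=
  hh.smooth.differentiable (by norm_num)

lemma monotone (hh : IsFunnel d R α L h) : Monotone h :=
  monotone_of_deriv_nonneg hh.differentiable hh.deriv_nonneg

lemma le_h (hh : IsFunnel d R α L h) (x : ℝ) : R ≤ h x := by
  rcases le_total x 0 with hx | hx
  · exact (hh.left x hx).ge
  · exact (hh.left 0 le_rfl).symm.le.trans (hh.monotone hx)

lemma h_pos (hh : IsFunnel d R α L h) (x : ℝ) : 0 < h x := hh.Rpos.trans_le (hh.le_h x)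

lemma isOpen_funnel (hh : IsFunnel d R α L h) : IsOpen (funnel d h) := by
  have := hh.smooth.continuous
  have h2 : Continuous (primeNorm : Euc d → ℝ) := continuous_primeNorm
  exact isOpen_lt h2 (by fun_prop)

lemma mem_funnel_iff (hh : IsFunnel d R α L h) (x : Euc d) :
    x ∈ funnel d h ↔ 0 < levelFn h x := by
  rw [levelFn, ← primeNorm_sq, sub_pos, sq_lt_sq₀ (primeNorm_nonneg x) (hh.h_pos _).le]
  rfl

lemma closure_funnel (hh : IsFunnel d R α L h) :
    closure (funnel d h) = {x | primeNorm x ≤ h (x 0)} := by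
  have hc := hh.smooth.continuous
  have h2 : Continuous (primeNorm : Euc d → ℝ) := continuous_primeNorm
  apply Subset.antisymm
  · exact closure_minimal (fun x (hx : primeNorm x < h (x 0)) => hx.le)
      (isClosed_le h2 (by fun_prop))
  · intro x hx
    rw [mem_ofPred_eq] at hx
    have key : Tendsto (fun s : ℝ => x - s • primeProj d x) (𝓝[>] 0) (𝓝 x) := by
      have : Continuous (fun s : ℝ => x - s • primeProj d x) := by fun_prop
      have := (this.tendsto 0).mono_left (nhdsWithin_le_nhds (s := Ioi 0))
      simpa using this
    refine mem_closure_of_tendsto key ?_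
    filter_upwards [Ioo_mem_nhdsGT (zero_lt_one' ℝ)] with s hs
    have e0 : (x - s • primeProj d x) 0 = x 0 := by simp [primeProj_apply]
    have e1 : primeProj d (x - s • primeProj d x) = (1 - s) • primeProj d x := by
      ext i
      simp only [primeProj_apply, PiLp.sub_apply, PiLp.smul_apply, smul_eq_mul]
      split_ifs <;> ring
    change primeNorm _ < h _
    rw [e0, primeNorm_eq_norm, e1, norm_smul, Real.norm_eq_abs, abs_of_pos (by linarith [hs.2]),
      ← primeNorm_eq_norm]
    nlinarith [primeNorm_nonneg x, hs.1, hs.2, hh.h_pos (x 0)]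

lemma mem_closure_iff (hh : IsFunnel d R α L h) (x : Euc d) :
    x ∈ closure (funnel d h) ↔ 0 ≤ levelFn h x := by
  rw [hh.closure_funnel, levelFn, ← primeNorm_sq, sub_nonneg,
    sq_le_sq₀ (primeNorm_nonneg x) (hh.h_pos _).le]
  rfl

lemma mem_frontier_iff (hh : IsFunnel d R α L h) (x : Euc d) :
    x ∈ frontier (funnel d h) ↔ levelFn h x = 0 := by
  rw [hh.isOpen_funnel.frontier_eq, Set.mem_sdiff, hh.mem_closure_iff, hh.mem_funnel_iff, not_lt]
  exact ⟨fun hx => le_antisymm hx.2 hx.1, fun hx => ⟨hx.ge, hx.le⟩⟩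

lemma uniqueDiffOn (hh : IsFunnel d R α L h) : UniqueDiffOn ℝ (closure (funnel d h)) := by
  intro x hx
  have hx' := hx
  rw [hh.closure_funnel] at hx'
  obtain ⟨hc, hi⟩ := convex_halfCylinder (d := d) (a := x 0) (hh.h_pos (x 0))
  refine (uniqueDiffWithinAt_convex hc hi (subset_closure ⟨le_rfl, hx'⟩)).mono ?_
  rintro y ⟨hy1, hy2⟩
  rw [hh.closure_funnel]
  exact hy2.trans (hh.monotone hy1)

lemma cos_pos (hh : IsFunnel d R α L h) : 0 < Real.cos α :=
  Real.cos_pos_of_mem_Ioo ⟨by linarith [hh.αmem.1, Real.pi_pos], hh.αmem.2⟩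

lemma starShaped (hh : IsFunnel d R α L h) (x : ℝ) :
    0 ≤ h x - deriv h x * (x - L * Real.cos α) := by
  rcases le_or_gt x (L * Real.cos α) with hx | hx
  · have := mul_nonneg (hh.deriv_nonneg x) (sub_nonneg.2 hx)
    linarith [hh.h_pos x]
  · have e : h =ᶠ[𝓝 x] fun y => y * Real.tan α := by
      filter_upwards [Ioi_mem_nhds hx] with y hy using hh.right y (le_of_lt hy)
    have e1 : deriv h x = Real.tan α := by
      rw [e.deriv_eq]; simp
    rw [e1, hh.right x hx.le]
    have h1 : 0 ≤ Real.tan α := Real.tan_nonneg_of_nonneg_of_le_pi_div_two hh.αmem.1 hh.αmem.2.le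
    have h2 : 0 < L * Real.cos α := mul_pos (hh.Rpos.trans hh.RL) hh.cos_pos
    nlinarith [mul_nonneg h2.le h1]

end IsFunnel

/-! ### Partial derivatives within a set -/

/-- The `i`-th partial derivative of `g` within `s`. -/
def pdW {d : ℕ} (s : Set (Euc d)) (g : Euc d → ℝ) (i : Fin (d + 1)) (x : Euc d) : ℝ :=
  fderivWithin ℝ g s x (EuclideanSpace.single i 1)

section partialDerivatives

variable {d : ℕ} {s : Set (Euc d)} {g k : Euc d → ℝ}

lemma lapW_eq (s : Set (Euc d)) (g : Euc d → ℝ) (x : Euc d) :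
    lapW s g x = ∑ i, pdW s (pdW s g i) i x := rfl

lemma neumannLHS_eq (h : ℝ → ℝ) (g : Euc d → ℝ) (x : Euc d) :
    neumannLHS h g x = (Real.sqrt (1 + deriv h (x 0) ^ 2))⁻¹ *
      (-(deriv h (x 0)) * pdW (closure (funnel d h)) g 0 x
        + ∑ i, if i = 0 then 0 else
          (x i / primeNorm x) * pdW (closure (funnel d h)) g i x) := rfl

lemma contDiffOn_pdW {n : ℕ} (hs : UniqueDiffOn ℝ s) (hg : ContDiffOn ℝ (n + 1 : ℕ) g s)
    (i : Fin (d + 1)) : ContDiffOn ℝ n (pdW s g i) s :=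
  (hg.fderivWithin hs (by norm_cast)).clm_apply contDiffOn_const

lemma continuousOn_pdW_pdW (hs : UniqueDiffOn ℝ s) (hg : ContDiffOn ℝ 2 g s)
    (i j : Fin (d + 1)) : ContinuousOn (pdW s (pdW s g i) j) s :=
  (contDiffOn_pdW (n := 0) hs
    (contDiffOn_pdW (n := 1) hs (by exact_mod_cast hg) i) j).continuousOn

lemma continuousOn_lapW (hs : UniqueDiffOn ℝ s) (hg : ContDiffOn ℝ 2 g s) :
    ContinuousOn (lapW s g) s := by
  have : lapW s g = fun x => ∑ i, pdW s (pdW s g i) i x := rfl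
  rw [this]
  exact continuousOn_finsetSum _ fun i _ => continuousOn_pdW_pdW hs hg i i

lemma pdW_congr (hgk : ∀ y ∈ s, g y = k y) (i : Fin (d + 1)) {x : Euc d} (hx : x ∈ s) :
    pdW s g i x = pdW s k i x := by
  rw [pdW, fderivWithin_congr hgk (hgk x hx), pdW]

lemma pdW_sub (hs : UniqueDiffOn ℝ s) (hg : DifferentiableOn ℝ g s)
    (hk : DifferentiableOn ℝ k s) (i : Fin (d + 1)) {x : Euc d} (hx : x ∈ s) :
    pdW s (fun y => g y - k y) i x = pdW s g i x - pdW s k i x := by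
  rw [pdW, fderivWithin_fun_sub (hs x hx) (hg x hx) (hk x hx)]
  rfl

lemma lapW_sub (hs : UniqueDiffOn ℝ s) (hg : ContDiffOn ℝ 2 g s) (hk : ContDiffOn ℝ 2 k s)
    {x : Euc d} (hx : x ∈ s) :
    lapW s (fun y => g y - k y) x = lapW s g x - lapW s k x := by
  simp only [lapW_eq, ← Finset.sum_sub_distrib]
  refine Finset.sum_congr rfl fun i _ => ?_
  rw [pdW_congr (k := fun y => pdW s g i y - pdW s k i y) (fun y hy => pdW_sub hs
    (hg.differentiableOn (by norm_num)) (hk.differentiableOn (by norm_num)) i hy) i hx]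
  exact pdW_sub hs
    ((contDiffOn_pdW (n := 1) hs (by exact_mod_cast hg) i).differentiableOn (by norm_num))
    ((contDiffOn_pdW (n := 1) hs (by exact_mod_cast hk) i).differentiableOn (by norm_num)) i hx

lemma lapW_sub_const (hs : UniqueDiffOn ℝ s) (hg : ContDiffOn ℝ 2 g s) (c : ℝ)
    {x : Euc d} (hx : x ∈ s) : lapW s (fun y => g y - c) x = lapW s g x := by
  have h0 : ∀ i, pdW s (fun _ => c) i = fun _ => 0 := fun i => by
    funext y; simp [pdW]
  rw [lapW_sub hs hg contDiffOn_const hx, lapW_eq s fun _ => c]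
  simp only [h0]
  simp [pdW]

lemma neumannLHS_sub {h : ℝ → ℝ} (hs : UniqueDiffOn ℝ (closure (funnel d h)))
    (hg : DifferentiableOn ℝ g (closure (funnel d h)))
    (hk : DifferentiableOn ℝ k (closure (funnel d h)))
    {x : Euc d} (hx : x ∈ closure (funnel d h)) :
    neumannLHS h (fun y => g y - k y) x = neumannLHS h g x - neumannLHS h k x := by
  simp only [neumannLHS_eq, pdW_sub hs hg hk _ hx, ← mul_sub]
  congr 1
  have : ∀ i, (if i = 0 then (0 : ℝ) else x i / primeNorm x *
      (pdW (closure (funnel d h)) g i x - pdW (closure (funnel d h)) k i x)) =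
      (if i = 0 then 0 else x i / primeNorm x * pdW (closure (funnel d h)) g i x) -
      (if i = 0 then 0 else x i / primeNorm x * pdW (closure (funnel d h)) k i x) := by
    intro i; split_ifs <;> ring
  simp only [this, Finset.sum_sub_distrib]
  ring

lemma neumannLHS_sub_const {h : ℝ → ℝ} (hs : UniqueDiffOn ℝ (closure (funnel d h)))
    (hg : DifferentiableOn ℝ g (closure (funnel d h))) (c : ℝ)
    {x : Euc d} (hx : x ∈ closure (funnel d h)) :
    neumannLHS h (fun y => g y - c) x = neumannLHS h g x := by
  rw [neumannLHS_sub hs hg (differentiableOn_const c) hx, neumannLHS_eq h fun _ => c]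
  simp [pdW]

lemma hasFDerivAt_radial {Ψ : ℝ → ℝ} {Ψ' : ℝ} (ξ x : Euc d)
    (hΨ : HasDerivAt Ψ Ψ' (‖x - ξ‖ ^ 2)) :
    HasFDerivAt (fun y : Euc d => Ψ (‖y - ξ‖ ^ 2)) ((2 * Ψ') • innerSL ℝ (x - ξ)) x := by
  have h1 : HasFDerivAt (fun y : Euc d => ‖y - ξ‖ ^ 2) ((2 : ℝ) • innerSL ℝ (x - ξ)) x := by
    have h2 : HasFDerivAt (fun y : Euc d => y - ξ) (ContinuousLinearMap.id ℝ (Euc d)) x :=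
      (hasFDerivAt_id x).sub_const ξ
    have h3 := h2.norm_sq
    have e : (2 : ℝ) • innerSL ℝ (x - ξ) =
        2 • (innerSL ℝ (x - ξ)).comp (ContinuousLinearMap.id ℝ (Euc d)) := by
      rw [ofNat_smul_eq_nsmul]; rfl
    rw [e]
    exact h3
  rw [mul_comm, mul_smul]
  exact hΨ.comp_hasFDerivAt x h1

lemma pdW_radial (hs : UniqueDiffOn ℝ s) {Ψ Ψ₁ : ℝ → ℝ} (ξ : Euc d)
    (h1 : ∀ r ≥ 0, HasDerivAt Ψ (Ψ₁ r) r) (i : Fin (d + 1)) {x : Euc d} (hx : x ∈ s) :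
    pdW s (fun y => Ψ (‖y - ξ‖ ^ 2)) i x = 2 * Ψ₁ (‖x - ξ‖ ^ 2) * (x i - ξ i) := by
  rw [pdW, ((hasFDerivAt_radial ξ x (h1 _ (by positivity))).hasFDerivWithinAt).fderivWithin
    (hs x hx)]
  simp [EuclideanSpace.inner_single_right]

lemma lapW_radial (hs : UniqueDiffOn ℝ s) {Ψ Ψ₁ Ψ₂ : ℝ → ℝ} (ξ : Euc d)
    (h1 : ∀ r ≥ 0, HasDerivAt Ψ (Ψ₁ r) r) (h2 : ∀ r ≥ 0, HasDerivAt Ψ₁ (Ψ₂ r) r)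
    {x : Euc d} (hx : x ∈ s) :
    lapW s (fun y => Ψ (‖y - ξ‖ ^ 2)) x =
      4 * ‖x - ξ‖ ^ 2 * Ψ₂ (‖x - ξ‖ ^ 2) + 2 * (d + 1) * Ψ₁ (‖x - ξ‖ ^ 2) := by
  have key : ∀ i, pdW s (pdW s (fun y => Ψ (‖y - ξ‖ ^ 2)) i) i x =
      4 * Ψ₂ (‖x - ξ‖ ^ 2) * (x i - ξ i) ^ 2 + 2 * Ψ₁ (‖x - ξ‖ ^ 2) := by
    intro i
    rw [pdW_congr (fun y hy => pdW_radial hs ξ h1 i hy) i hx]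
    have d1 := (hasFDerivAt_radial ξ x (h2 _ (by positivity))).const_mul 2
    have d2 : HasFDerivAt (fun y : Euc d => y i - ξ i)
        (EuclideanSpace.proj i : Euc d →L[ℝ] ℝ) x :=
      (EuclideanSpace.proj i : Euc d →L[ℝ] ℝ).hasFDerivAt.sub_const (ξ i)
    rw [pdW, (d1.fun_mul d2).hasFDerivWithinAt.fderivWithin (hs x hx)]
    simp [EuclideanSpace.inner_single_right]
    ring
  rw [lapW_eq, Finset.sum_congr rfl fun i _ => key i, Finset.sum_add_distrib, ← Finset.mul_sum,
    EuclideanSpace.real_norm_sq_eq]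
  simp
  ring

lemma contDiff_radial {Ψ : ℝ → ℝ} (hΨ : ContDiff ℝ 2 Ψ) (ξ : Euc d) :
    ContDiff ℝ 2 fun y : Euc d => Ψ (‖y - ξ‖ ^ 2) :=
  hΨ.comp ((contDiff_id.sub contDiff_const).norm_sq ℝ)

lemma neumannLHS_radial {R α L : ℝ} {h : ℝ → ℝ} (hh : IsFunnel d R α L h) {Ψ Ψ₁ : ℝ → ℝ}
    (a : ℝ) (h1 : ∀ r ≥ 0, HasDerivAt Ψ (Ψ₁ r) r) {x : Euc d}
    (hx : x ∈ frontier (funnel d h)) :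
    neumannLHS h (fun y => Ψ (‖y - axisPt d a‖ ^ 2)) x =
      2 * (Real.sqrt (1 + deriv h (x 0) ^ 2))⁻¹ * Ψ₁ (‖x - axisPt d a‖ ^ 2) *
        (h (x 0) - deriv h (x 0) * (x 0 - a)) := by
  have hx' : x ∈ closure (funnel d h) := frontier_subset_closure hx
  rw [hh.mem_frontier_iff, levelFn, ← primeNorm_sq, sub_eq_zero,
    sq_eq_sq₀ (hh.h_pos _).le (primeNorm_nonneg _)] at hx
  have hp : primeNorm x ≠ 0 := by rw [← hx]; exact (hh.h_pos _).ne'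
  simp only [neumannLHS_eq, pdW_radial hh.uniqueDiffOn _ h1 _ hx']
  have : ∀ i, (if i = 0 then (0 : ℝ) else x i / primeNorm x *
      (2 * Ψ₁ (‖x - axisPt d a‖ ^ 2) * (x i - axisPt d a i))) =
      2 * Ψ₁ (‖x - axisPt d a‖ ^ 2) / primeNorm x * (if i = 0 then 0 else x i ^ 2) := by
    intro i
    split_ifs with hi
    · ring
    · rw [axisPt_apply, if_neg hi]; ring
  rw [Finset.sum_congr rfl fun i _ => this i, ← Finset.mul_sum]
  change _ * (_ + _ * primeSq x) = _
  rw [← primeNorm_sq, axisPt_apply, if_pos rfl, hx]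
  field_simp
  ring

end partialDerivatives

/-! ### A divergence inequality in the funnel -/

section divergence

variable {d : ℕ} {R α L : ℝ} {h : ℝ → ℝ}

lemma integral_fderiv_apply_eq_zero {X : Euc d → ℝ} (hX : ContDiff ℝ 1 X)
    (hc : HasCompactSupport X) (v : Euc d) : ∫ x, fderiv ℝ X x v = 0 := by
  have hInteg : Integrable (fun x => fderiv ℝ X x v) :=
    ((hX.continuous_fderiv (by norm_num)).clm_apply
      continuous_const).integrable_of_hasCompactSupport
      (hc.fderiv_apply ℝ v)
  have := integral_mul_fderiv_eq_neg_fderiv_mul_of_integrable (μ := volume)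
    (f := fun _ : Euc d => (1 : ℝ)) (g := X) (v := v) (by simp) (by simpa using hInteg)
    (by simpa using hX.continuous.integrable_of_hasCompactSupport hc)
    (fun x _ => differentiableAt_const _) (fun x _ => hX.differentiable (by norm_num) x)
  simpa using this

lemma contDiff_levelFn (hh : IsFunnel d R α L h) :
    ContDiff ℝ 2 (levelFn h : Euc d → ℝ) := by
  have e : (levelFn h : Euc d → ℝ) =
      fun x => h ((EuclideanSpace.proj (0 : Fin (d + 1)) : Euc d →L[ℝ] ℝ) x) ^ 2
        - ‖primeProj d x‖ ^ 2 := by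
    funext x
    rw [levelFn, ← primeNorm_sq, primeNorm_eq_norm]; rfl
  rw [e]
  exact ((hh.smooth.comp (ContinuousLinearMap.contDiff _)).pow 2).sub
    ((ContinuousLinearMap.contDiff _).norm_sq ℝ)

lemma continuous_levelFn (hh : IsFunnel d R α L h) : Continuous (levelFn h : Euc d → ℝ) :=
  (contDiff_levelFn hh).continuous

lemma fderiv_levelFn (hh : IsFunnel d R α L h) (x : Euc d) (i : Fin (d + 1)) :
    fderiv ℝ (levelFn h) x (EuclideanSpace.single i 1) =
      if i = 0 then 2 * h (x 0) * deriv h (x 0) else -2 * x i := by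
  have hp : ∀ j : Fin (d + 1), HasFDerivAt (fun y : Euc d => y j)
      (EuclideanSpace.proj j : Euc d →L[ℝ] ℝ) x := fun j =>
    (EuclideanSpace.proj j : Euc d →L[ℝ] ℝ).hasFDerivAt
  have h1 : HasFDerivAt (fun y : Euc d => h (y 0))
      (deriv h (x 0) • (EuclideanSpace.proj 0 : Euc d →L[ℝ] ℝ)) x :=
    (hh.differentiable (x 0)).hasDerivAt.comp_hasFDerivAt x (hp 0)
  have h2 : HasFDerivAt (fun y : Euc d => primeSq y)
      (∑ j, if j = 0 then 0 else (2 * x j) • (EuclideanSpace.proj j : Euc d →L[ℝ] ℝ)) x := by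
    unfold primeSq
    refine HasFDerivAt.fun_sum fun j _ => ?_
    split_ifs with hj
    · exact hasFDerivAt_const _ _
    · simpa using (hp j).pow 2
  have h3 : HasFDerivAt (levelFn h : Euc d → ℝ)
      ((2 * h (x 0)) • (deriv h (x 0) • (EuclideanSpace.proj 0 : Euc d →L[ℝ] ℝ)) -
      (∑ j, if j = 0 then 0 else (2 * x j) • (EuclideanSpace.proj j : Euc d →L[ℝ] ℝ))) x := by
    have h4 := (h1.pow 2).fun_sub h2
    simp only [Nat.add_one_sub_one, pow_one, nsmul_eq_mul, Nat.cast_ofNat] at h4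
    exact h4
  rw [h3.fderiv]
  have e : (∑ j, if j = 0 then (0 : Euc d →L[ℝ] ℝ) else
      (2 * x j) • (EuclideanSpace.proj j : Euc d →L[ℝ] ℝ)) (EuclideanSpace.single i 1) =
      if i = 0 then 0 else 2 * x i := by
    rw [_root_.sum_apply, Finset.sum_eq_single i]
    · split_ifs <;> simp
    · intro j _ hj
      split_ifs
      · rfl
      · simp [hj]
    · simp
  rw [_root_.sub_apply, e]
  split_ifs with hi
  · subst hi; simp
  · simp [Ne.symm hi]

/-- A smooth nondecreasing cutoff vanishing on `(-∞, 1/2]` and equal to `1` on `[1, ∞)`. -/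
def cutoff (s : ℝ) : ℝ := Real.smoothTransition (2 * s - 1)

lemma contDiff_cutoff {n : ℕ} : ContDiff ℝ n cutoff :=
  Real.smoothTransition.contDiff.comp (by fun_prop)

lemma monotone_cutoff : Monotone cutoff := fun a b hab =>
  Real.smoothTransition.monotone (by linarith)

lemma cutoff_zero {s : ℝ} (hs : s ≤ 1 / 2) : cutoff s = 0 :=
  Real.smoothTransition.zero_of_nonpos (by linarith)

lemma cutoff_one {s : ℝ} (hs : 1 ≤ s) : cutoff s = 1 :=
  Real.smoothTransition.one_of_one_le (by linarith)

lemma pdW_eq_fderiv (hh : IsFunnel d R α L h) {g : Euc d → ℝ} {x : Euc d}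
    (hx : x ∈ funnel d h) (i : Fin (d + 1)) :
    pdW (closure (funnel d h)) g i x = fderiv ℝ g x (EuclideanSpace.single i 1) := by
  rw [pdW, fderivWithin_of_mem_nhds (mem_of_superset (hh.isOpen_funnel.mem_nhds hx) subset_closure)]

lemma pdW_eq_zero_of_norm_gt (hh : IsFunnel d R α L h) {g : Euc d → ℝ} {ξ x : Euc d} {P' : ℝ}
    (hg : ∀ y ∈ closure (funnel d h), g y ≠ 0 → ‖y - ξ‖ ≤ P')
    (hx : x ∈ funnel d h) (hxP : P' < ‖x - ξ‖) (i : Fin (d + 1)) :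
    pdW (closure (funnel d h)) g i x = 0 := by
  have e : g =ᶠ[𝓝 x] fun _ => 0 := by
    have ho : IsOpen {y : Euc d | P' < ‖y - ξ‖} := isOpen_lt continuous_const (by fun_prop)
    filter_upwards [ho.mem_nhds hxP, hh.isOpen_funnel.mem_nhds hx] with y hy hy'
    by_contra hne
    exact absurd (hg y (subset_closure hy') hne) (not_le.2 hy)
  rw [pdW_eq_fderiv hh hx, e.fderiv_eq]
  simp

lemma isCompact_closure_inter (h : ℝ → ℝ) (ξ : Euc d) (P : ℝ) :
    IsCompact (closure (funnel d h) ∩ Metric.closedBall ξ P) :=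
  (isCompact_closedBall ξ P).inter_left isClosed_closure

/-- Continuous functions on the closed funnel are integrable on bounded pieces. -/
lemma integrableOn_of_continuousOn {g : Euc d → ℝ}
    (hg : ContinuousOn g (closure (funnel d h))) (ξ : Euc d) (P : ℝ) :
    IntegrableOn g (funnel d h ∩ Metric.ball ξ P) :=
  ((hg.mono inter_subset_left).integrableOn_compact (isCompact_closure_inter h ξ P)).mono_set
    (inter_subset_inter subset_closure Metric.ball_subset_closedBall)

theorem integral_div_le_zero (hh : IsFunnel d R α L h) {ξ : Euc d} {P P' ε₀ : ℝ} (hP : P' < P)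
    {Z : Fin (d + 1) → Euc d → ℝ} (hZ : ∀ i, ContDiffOn ℝ 1 (Z i) (closure (funnel d h)))
    (hsupp : ∀ i, ∀ x ∈ closure (funnel d h), Z i x ≠ 0 → ‖x - ξ‖ ≤ P') (hε₀ : 0 < ε₀)
    (hG : ∀ x ∈ funnel d h, levelFn h x ≤ ε₀ →
      0 ≤ ∑ i, fderiv ℝ (levelFn h) x (EuclideanSpace.single i 1) * Z i x) :
    ∫ x in funnel d h ∩ Metric.ball ξ P, ∑ i, pdW (closure (funnel d h)) (Z i) i x ≤ 0 := by
  set Ω := funnel d h with hΩ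
  set D := Ω ∩ Metric.ball ξ P with hD
  have hmeas : MeasurableSet D := (hh.isOpen_funnel.inter Metric.isOpen_ball).measurableSet
  have hGc : ContDiff ℝ 2 (levelFn h : Euc d → ℝ) := contDiff_levelFn hh
  have hdivc : ContinuousOn (fun x => ∑ i, pdW (closure Ω) (Z i) i x) (closure Ω) :=
    continuousOn_finsetSum _ fun i _ =>
      (contDiffOn_pdW (n := 0) hh.uniqueDiffOn (by exact_mod_cast hZ i) i).continuousOn
  have hdivi := integrableOn_of_continuousOn hdivc ξ P
  have key : ∀ ε ∈ Ioc 0 ε₀, ∫ x in D, cutoff (levelFn h x / ε) *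
      ∑ i, pdW (closure Ω) (Z i) i x ≤ 0 := by
    rintro ε ⟨hε, hεε⟩
    set ζ : Euc d → ℝ := fun x => cutoff (levelFn h x / ε) with hζ
    have hζc : ContDiff ℝ 1 ζ :=
      (contDiff_cutoff (n := 1)).comp ((hGc.of_le (by norm_num)).div_const ε)
    set X : Fin (d + 1) → Euc d → ℝ := fun i x => ζ x * Z i x with hXdef
    have hout : ∀ x ∉ Ω, ζ =ᶠ[𝓝 x] fun _ => 0 := by
      intro x hx
      rw [hh.mem_funnel_iff, not_lt] at hx
      have ho : IsOpen {y : Euc d | levelFn h y < ε / 2} :=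
        isOpen_lt hGc.continuous continuous_const
      filter_upwards [ho.mem_nhds (show levelFn h x < ε / 2 by linarith)] with y hy
      refine cutoff_zero ?_
      rw [div_le_iff₀ hε]
      have : levelFn h y < ε / 2 := hy
      linarith
    have hXout : ∀ i, ∀ x ∉ Ω, X i =ᶠ[𝓝 x] fun _ => 0 := by
      intro i x hx
      filter_upwards [hout x hx] with y hy
      simp [hXdef, hy]
    have hZat : ∀ i, ∀ x ∈ Ω, ContDiffAt ℝ 1 (Z i) x := fun i x hx =>
      (hZ i).contDiffAt (mem_of_superset (hh.isOpen_funnel.mem_nhds hx) subset_closure)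
    have hXc : ∀ i, ContDiff ℝ 1 (X i) := by
      intro i
      rw [contDiff_iff_contDiffAt]
      intro x
      by_cases hx : x ∈ Ω
      · exact hζc.contDiffAt.mul (hZat i x hx)
      · exact contDiffAt_const.congr_of_eventuallyEq (hXout i x hx)
    have hXs : ∀ i, HasCompactSupport (X i) := by
      intro i
      refine HasCompactSupport.intro (isCompact_closedBall ξ P') fun x hx => ?_
      by_cases hxΩ : x ∈ Ω
      · by_contra hne
        exact hx (mem_closedBall_iff_norm.2
          (hsupp i x (subset_closure hxΩ) (right_ne_zero_of_mul hne)))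
      · exact (hXout i x hxΩ).eq_of_nhds
    have hXi : ∀ i, Integrable fun x => fderiv ℝ (X i) x (EuclideanSpace.single i 1) := fun i =>
      (((hXc i).continuous_fderiv (by norm_num)).clm_apply
        continuous_const).integrable_of_hasCompactSupport ((hXs i).fderiv_apply ℝ _)
    have h0 : ∫ x, ∑ i, fderiv ℝ (X i) x (EuclideanSpace.single i 1) = 0 := by
      rw [integral_finsetSum _ fun i _ => hXi i]
      exact Finset.sum_eq_zero fun i _ => integral_fderiv_apply_eq_zero (hXc i) (hXs i) _
    have hpt : ∀ x, D.indicator (fun x => ζ x * ∑ i, pdW (closure Ω) (Z i) i x) x ≤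
        ∑ i, fderiv ℝ (X i) x (EuclideanSpace.single i 1) := by
      intro x
      by_cases hx : x ∈ Ω
      · have e1 : ∀ i, fderiv ℝ (X i) x (EuclideanSpace.single i 1) =
            ζ x * pdW (closure Ω) (Z i) i x +
            deriv cutoff (levelFn h x / ε) / ε *
              (fderiv ℝ (levelFn h) x (EuclideanSpace.single i 1) * Z i x) := by
          intro i
          have hz : HasFDerivAt ζ ((deriv cutoff (levelFn h x / ε)) •
              ((ε⁻¹ : ℝ) • fderiv ℝ (levelFn h) x)) x := by
            have a1 : HasFDerivAt (fun y : Euc d => levelFn h y / ε)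
                ((ε⁻¹ : ℝ) • fderiv ℝ (levelFn h) x) x := by
              simp only [div_eq_mul_inv]
              exact (hGc.differentiable (by norm_num) x).hasFDerivAt.mul_const ε⁻¹
            exact ((contDiff_cutoff (n := 1)).differentiable
              (by norm_num) _).hasDerivAt.comp_hasFDerivAt x a1
          rw [(hz.fun_mul ((hZat i x hx).differentiableAt (by norm_num)).hasFDerivAt).fderiv,
            pdW_eq_fderiv hh hx]
          simp
          ring
        have e2 : 0 ≤ deriv cutoff (levelFn h x / ε) / ε *
            ∑ i, (fderiv ℝ (levelFn h) x (EuclideanSpace.single i 1) * Z i x) := by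
          by_cases hxε : levelFn h x ≤ ε₀
          · exact mul_nonneg (div_nonneg monotone_cutoff.deriv_nonneg hε.le) (hG x hx hxε)
          · have : cutoff =ᶠ[𝓝 (levelFn h x / ε)] fun _ => 1 := by
              have : 1 < levelFn h x / ε := by rw [lt_div_iff₀ hε]; linarith
              filter_upwards [Ioi_mem_nhds this] with s hs using cutoff_one (le_of_lt hs)
            rw [this.deriv_eq]
            simp
        rw [Finset.sum_congr rfl fun i _ => e1 i, Finset.sum_add_distrib, ← Finset.mul_sum,
          ← Finset.mul_sum]
        by_cases hxD : x ∈ D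
        · rw [indicator_of_mem hxD]; linarith
        · rw [indicator_of_notMem hxD]
          have hxP : P' < ‖x - ξ‖ := by
            by_contra hle
            exact hxD ⟨hx, mem_ball_iff_norm.2 (by linarith)⟩
          have : ∀ i, pdW (closure Ω) (Z i) i x = 0 := fun i =>
            pdW_eq_zero_of_norm_gt hh (hsupp i) hx hxP i
          simp only [this, Finset.sum_const_zero, mul_zero, zero_add]
          exact e2
      · rw [indicator_of_notMem fun hxD => hx hxD.1]
        refine Finset.sum_nonneg fun i _ => ?_
        rw [(hXout i x hx).fderiv_eq]
        simp
    rw [← h0, ← integral_indicator hmeas]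
    refine integral_mono ?_ (integrable_finsetSum _ fun i _ => hXi i) hpt
    rw [integrable_indicator_iff hmeas]
    exact integrableOn_of_continuousOn (hζc.continuous.continuousOn.mul hdivc) ξ P
  have hlim : Tendsto (fun n : ℕ => ∫ x in D, cutoff (levelFn h x / (ε₀ / (n + 1))) *
      ∑ i, pdW (closure Ω) (Z i) i x) atTop
      (𝓝 (∫ x in D, ∑ i, pdW (closure Ω) (Z i) i x)) := by
    refine tendsto_integral_of_dominated_convergence
      (fun x => ‖∑ i, pdW (closure Ω) (Z i) i x‖) ?_ hdivi.norm ?_ ?_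
    · intro n
      have hc : Continuous fun x : Euc d => cutoff (levelFn h x / (ε₀ / (n + 1))) :=
        (contDiff_cutoff (n := 1)).continuous.comp (hGc.continuous.div_const _)
      exact (integrableOn_of_continuousOn (hc.continuousOn.mul hdivc) ξ P).aestronglyMeasurable
    · intro n
      filter_upwards with x
      rw [norm_mul]
      refine mul_le_of_le_one_left (norm_nonneg _) ?_
      rw [cutoff, Real.norm_of_nonneg (Real.smoothTransition.nonneg _)]
      exact Real.smoothTransition.le_one _
    · refine (ae_restrict_iff' hmeas).2 (ae_of_all _ fun x hx => ?_)
      have hGx : 0 < levelFn h x := (hh.mem_funnel_iff x).1 hx.1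
      obtain ⟨n₀, hn₀⟩ := exists_nat_gt (ε₀ / levelFn h x)
      refine tendsto_const_nhds.congr' ?_
      filter_upwards [eventually_ge_atTop n₀] with n hn
      rw [cutoff_one, one_mul]
      have hn' : (n₀ : ℝ) ≤ n := by exact_mod_cast hn
      rw [div_lt_iff₀ hGx] at hn₀
      rw [le_div_iff₀ (by positivity), one_mul, div_le_iff₀ (by positivity)]
      nlinarith
  refine le_of_tendsto' hlim fun n => key _ ⟨by positivity, ?_⟩
  exact div_le_self hε₀.le (by linarith [Nat.cast_nonneg (α := ℝ) n])

end divergence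

/-! ### A Green-type inequality for positive parts -/

section green

variable {d : ℕ} {R α L : ℝ} {h : ℝ → ℝ}

/-- A smooth radial function vanishing on `‖x - ξ‖ ≤ a` and equal to `1` on `‖x - ξ‖ ≥ b`. -/
def radialStep (ξ : Euc d) (a b : ℝ) (x : Euc d) : ℝ :=
  Real.smoothTransition ((‖x - ξ‖ ^ 2 - a ^ 2) / (b ^ 2 - a ^ 2))

lemma contDiff_radialStep {n : ℕ} (ξ : Euc d) (a b : ℝ) : ContDiff ℝ n (radialStep ξ a b) :=
  Real.smoothTransition.contDiff.comp
    ((((contDiff_id.sub contDiff_const).norm_sq ℝ).sub contDiff_const).div_const _)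

lemma radialStep_nonneg (ξ : Euc d) (a b : ℝ) (x : Euc d) : 0 ≤ radialStep ξ a b x :=
  Real.smoothTransition.nonneg _

lemma radialStep_le_one (ξ : Euc d) (a b : ℝ) (x : Euc d) : radialStep ξ a b x ≤ 1 :=
  Real.smoothTransition.le_one _

lemma radialStep_zero {ξ : Euc d} {a b : ℝ} (hab : a < b) (ha : 0 ≤ a) {x : Euc d}
    (hx : ‖x - ξ‖ ≤ a) : radialStep ξ a b x = 0 := by
  refine Real.smoothTransition.zero_of_nonpos (div_nonpos_of_nonpos_of_nonneg ?_ ?_)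
  · nlinarith [norm_nonneg (x - ξ)]
  · nlinarith

lemma radialStep_one {ξ : Euc d} {a b : ℝ} (hab : a < b) (ha : 0 ≤ a) {x : Euc d}
    (hx : b ≤ ‖x - ξ‖) : radialStep ξ a b x = 1 := by
  refine Real.smoothTransition.one_of_one_le ?_
  rw [le_div_iff₀ (by nlinarith)]
  nlinarith

lemma hasDerivAt_posPart_sq (s : ℝ) :
    HasDerivAt (fun s : ℝ => max s 0 ^ 2) (2 * max s 0) s := by
  rcases lt_trichotomy s 0 with hs | hs | hs
  · rw [max_eq_right hs.le, mul_zero]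
    refine (hasDerivAt_const s (0 : ℝ)).congr_of_eventuallyEq ?_
    filter_upwards [Iio_mem_nhds hs] with y hy
    rw [max_eq_right (le_of_lt hy)]; norm_num
  · subst hs
    rw [hasDerivAt_iff_isLittleO]
    simp only [max_self, mul_zero, smul_zero, sub_zero, ne_eq, OfNat.ofNat_ne_zero,
      not_false_eq_true, zero_pow]
    have : (fun x : ℝ => max x 0 ^ 2) =O[𝓝 0] fun x => x ^ 2 := by
      refine Asymptotics.IsBigO.of_bound 1 (Eventually.of_forall fun x => ?_)
      rw [one_mul, norm_pow, norm_pow]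
      refine pow_le_pow_left₀ (norm_nonneg _) ?_ 2
      rw [Real.norm_eq_abs, Real.norm_eq_abs, abs_of_nonneg (le_max_right _ _)]
      exact max_le (le_abs_self x) (abs_nonneg x)
    refine this.trans_isLittleO ?_
    exact Asymptotics.isLittleO_pow_id one_lt_two
  · rw [max_eq_left hs.le]
    have := (hasDerivAt_pow 2 s)
    simp only [Nat.cast_ofNat, Nat.add_one_sub_one, pow_one] at this
    refine this.congr_of_eventuallyEq ?_
    filter_upwards [Ioi_mem_nhds hs] with y hy
    rw [max_eq_left (le_of_lt hy)]

lemma contDiff_posPart_sq : ContDiff ℝ 1 fun s : ℝ => max s 0 ^ 2 := by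
  rw [contDiff_one_iff_deriv]
  refine ⟨fun s => (hasDerivAt_posPart_sq s).differentiableAt, ?_⟩
  rw [funext fun s => (hasDerivAt_posPart_sq s).deriv]
  fun_prop

lemma pdW_mul {s : Set (Euc d)} {g k : Euc d → ℝ} (hs : UniqueDiffOn ℝ s)
    (hg : DifferentiableOn ℝ g s) (hk : DifferentiableOn ℝ k s) (i : Fin (d + 1)) {x : Euc d}
    (hx : x ∈ s) :
    pdW s (fun y => g y * k y) i x = g x * pdW s k i x + pdW s g i x * k x := by
  rw [pdW, fderivWithin_fun_mul (hs x hx) (hg x hx) (hk x hx), pdW, pdW]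
  simp
  ring

lemma pdW_add {s : Set (Euc d)} {g k : Euc d → ℝ} (hs : UniqueDiffOn ℝ s)
    (hg : DifferentiableOn ℝ g s) (hk : DifferentiableOn ℝ k s) (i : Fin (d + 1)) {x : Euc d}
    (hx : x ∈ s) :
    pdW s (fun y => g y + k y) i x = pdW s g i x + pdW s k i x := by
  rw [pdW, fderivWithin_fun_add (hs x hx) (hg x hx) (hk x hx)]
  rfl

lemma pdW_const_mul {s : Set (Euc d)} {g : Euc d → ℝ} (hs : UniqueDiffOn ℝ s)
    (hg : DifferentiableOn ℝ g s) (c : ℝ) (i : Fin (d + 1)) {x : Euc d} (hx : x ∈ s) :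
    pdW s (fun y => c * g y) i x = c * pdW s g i x := by
  rw [pdW, fderivWithin_const_mul (hs x hx) (hg x hx), pdW]
  simp

lemma pdW_posPart_sq {s : Set (Euc d)} {v : Euc d → ℝ} (hs : UniqueDiffOn ℝ s)
    (hv : DifferentiableOn ℝ v s) (i : Fin (d + 1)) {x : Euc d} (hx : x ∈ s) :
    pdW s (fun y => max (v y) 0 ^ 2) i x = 2 * max (v x) 0 * pdW s v i x := by
  have := (hasDerivAt_posPart_sq (v x)).comp_hasFDerivWithinAt x (hv x hx).hasFDerivWithinAt
  rw [pdW]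
  erw [this.fderivWithin (hs x hx)]
  simp [pdW]

lemma sum_fderiv_levelFn_mul_pdW (hh : IsFunnel d R α L h) {v : Euc d → ℝ} {x : Euc d}
    (hx : x ∈ frontier (funnel d h)) :
    ∑ i, fderiv ℝ (levelFn h) x (EuclideanSpace.single i 1) * pdW (closure (funnel d h)) v i x =
      -(2 * h (x 0) * Real.sqrt (1 + deriv h (x 0) ^ 2)) * neumannLHS h v x := by
  rw [hh.mem_frontier_iff, levelFn, ← primeNorm_sq, sub_eq_zero,
    sq_eq_sq₀ (hh.h_pos _).le (primeNorm_nonneg _)] at hx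
  have hp : h (x 0) ≠ 0 := (hh.h_pos _).ne'
  have hs : Real.sqrt (1 + deriv h (x 0) ^ 2) ≠ 0 := by positivity
  rw [neumannLHS_eq, Fin.sum_univ_succ, Fin.sum_univ_succ, ← hx]
  simp only [fderiv_levelFn hh, Fin.succ_ne_zero, if_true, if_false]
  have : ∀ i : Fin d, x i.succ / h (x 0) * pdW (closure (funnel d h)) v i.succ x =
    (-(1 / (2 * h (x 0)))) * (-2 * x i.succ * pdW (closure (funnel d h)) v i.succ x) := by
    intro i; field_simp
  rw [Finset.sum_congr rfl fun i _ => this i, ← Finset.mul_sum]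
  field_simp
  ring

theorem integral_posPart_sq_mul_lapW_le (hh : IsFunnel d R α L h) {ξ : Euc d} {P P' : ℝ}
    (hP' : 0 ≤ P') (hP : P' < P) {v : Euc d → ℝ} (hv : ContDiffOn ℝ 2 v (closure (funnel d h)))
    (hsupp : ∀ x ∈ closure (funnel d h), 0 < v x → ‖x - ξ‖ ≤ P')
    (hN : ∀ x ∈ frontier (funnel d h), 0 < v x → neumannLHS h v x ≤ 0) :
    ∫ x in funnel d h ∩ Metric.ball ξ P,
      max (v x) 0 ^ 2 * lapW (closure (funnel d h)) v x ≤ 0 := by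
  set Ω := funnel d h with hΩ
  set D := Ω ∩ Metric.ball ξ P with hD
  have hud : UniqueDiffOn ℝ (closure Ω) := hh.uniqueDiffOn
  have hmeas : MeasurableSet D := (hh.isOpen_funnel.inter Metric.isOpen_ball).measurableSet
  obtain ⟨P₂, hP₂, hP₂'⟩ := exists_between hP
  -- the correction field
  let W : Fin (d + 1) → Euc d → ℝ := fun i x =>
    (1 - radialStep ξ P' P₂ x) * (if i = 0 then 0 else -x i)
  have hW : ∀ i, ContDiff ℝ 1 (W i) := by
    intro i
    refine (contDiff_const.sub (contDiff_radialStep (n := 1) ξ P' P₂)).mul ?_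
    split_ifs
    · exact contDiff_const
    · exact ((EuclideanSpace.proj i : Euc d →L[ℝ] ℝ).contDiff).neg
  have hWG : ∀ x, ∑ i, fderiv ℝ (levelFn h) x (EuclideanSpace.single i 1) * W i x =
      2 * (1 - radialStep ξ P' P₂ x) * primeSq x := by
    intro x
    rw [primeSq, Finset.mul_sum]
    refine Finset.sum_congr rfl fun i _ => ?_
    rw [fderiv_levelFn hh]
    simp only [W]
    split_ifs <;> ring
  have hvd : DifferentiableOn ℝ v (closure Ω) := hv.differentiableOn (by norm_num)
  have hpd : ∀ i, ContDiffOn ℝ 1 (pdW (closure Ω) v i) (closure Ω) := fun i =>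
    contDiffOn_pdW (n := 1) hud (by exact_mod_cast hv) i
  have hq : ContDiffOn ℝ 1 (fun x => max (v x) 0 ^ 2) (closure Ω) :=
    contDiff_posPart_sq.comp_contDiffOn (hv.of_le (by norm_num))
  set m : Euc d → ℝ := fun x =>
    ∑ i, fderiv ℝ (levelFn h) x (EuclideanSpace.single i 1) * pdW (closure Ω) v i x with hm
  have hmc : ContinuousOn m (closure Ω) := by
    refine continuousOn_finsetSum _ fun i _ => ContinuousOn.mul ?_ (hpd i).continuousOn
    exact (((contDiff_levelFn hh).continuous_fderiv (by norm_num)).clm_apply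
      continuous_const).continuousOn
  have hEc : ContinuousOn (fun x => ∑ i, pdW (closure Ω) (W i) i x) (closure Ω) :=
    continuousOn_finsetSum _ fun i _ =>
      (contDiffOn_pdW (n := 0) hud (by exact_mod_cast (hW i).contDiffOn) i).continuousOn
  have hlc : ContinuousOn (fun x => max (v x) 0 ^ 2 * lapW (closure Ω) v x) (closure Ω) :=
    hq.continuousOn.mul (continuousOn_lapW hud hv)
  have hgc : ContinuousOn (fun x => 2 * max (v x) 0 * ∑ i, pdW (closure Ω) v i x ^ 2)
      (closure Ω) := by
    refine (continuousOn_const.mul (hv.continuousOn.sup continuousOn_const)).mul ?_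
    exact continuousOn_finsetSum _ fun i _ => (hpd i).continuousOn.pow 2
  set B := ∫ x in D, ∑ i, pdW (closure Ω) (W i) i x with hB
  have key : ∀ η > 0, ∫ x in D, max (v x) 0 ^ 2 * lapW (closure Ω) v x ≤ -(η * B) := by
    intro η hη
    let Z : Fin (d + 1) → Euc d → ℝ := fun i x =>
      max (v x) 0 ^ 2 * pdW (closure Ω) v i x + η * W i x
    have hZG : ∀ x, ∑ i, fderiv ℝ (levelFn h) x (EuclideanSpace.single i 1) * Z i x =
        max (v x) 0 ^ 2 * m x + η * (2 * (1 - radialStep ξ P' P₂ x) * primeSq x) := by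
      intro x
      rw [← hWG, hm, Finset.mul_sum, Finset.mul_sum, ← Finset.sum_add_distrib]
      exact Finset.sum_congr rfl fun i _ => by simp only [Z]; ring
    have hZpos : ∀ x ∈ closure Ω, P' < ‖x - ξ‖ →
        0 ≤ max (v x) 0 ^ 2 * m x + η * (2 * (1 - radialStep ξ P' P₂ x) * primeSq x) := by
      intro x hx hxP
      have : v x ≤ 0 := by
        by_contra hlt
        exact absurd (hsupp x hx (not_le.1 hlt)) (not_le.2 hxP)
      rw [max_eq_right this]
      have h1 := radialStep_le_one ξ P' P₂ x
      have h2 := primeSq_nonneg x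
      have : 0 ≤ (1 - radialStep ξ P' P₂ x) * primeSq x := mul_nonneg (by linarith) h2
      nlinarith
    obtain ⟨ε₀, hε₀, hε₀G⟩ : ∃ ε₀ > 0, ∀ x ∈ Ω, levelFn h x ≤ ε₀ →
        0 ≤ max (v x) 0 ^ 2 * m x + η * (2 * (1 - radialStep ξ P' P₂ x) * primeSq x) := by
      set K : Set (Euc d) := (closure Ω ∩ Metric.closedBall ξ P') ∩
        (fun x => max (v x) 0 ^ 2 * m x + η * (2 * primeSq x)) ⁻¹' Iic 0
      have hpc : Continuous (primeSq : Euc d → ℝ) := by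
        have : (primeSq : Euc d → ℝ) = fun x => primeNorm x ^ 2 :=
          funext fun x => (primeNorm_sq x).symm
        rw [this]
        exact continuous_primeNorm.pow 2
      have hKc : IsCompact K := by
        have hcc := isCompact_closure_inter h ξ P'
        refine hcc.of_isClosed_subset ?_ inter_subset_left
        refine ContinuousOn.preimage_isClosed_of_isClosed ?_ hcc.isClosed isClosed_Iic
        refine ContinuousOn.mono ?_ inter_subset_left
        exact (hq.continuousOn.mul hmc).add (by fun_prop)
      have hpos : ∀ x ∈ K, 0 < levelFn h x := by
        rintro x ⟨⟨hx, -⟩, hxm⟩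
        refine lt_of_le_of_ne ((hh.mem_closure_iff x).1 hx) fun h0 => ?_
        have hfr : x ∈ frontier Ω := (hh.mem_frontier_iff x).2 h0.symm
        have hm0 : 0 ≤ max (v x) 0 ^ 2 * m x := by
          rcases le_or_gt (v x) 0 with hvx | hvx
          · rw [max_eq_right hvx]; simp
          · refine mul_nonneg (by positivity) ?_
            rw [hm]
            simp only
            rw [sum_fderiv_levelFn_mul_pdW hh hfr]
            have := hN x hfr hvx
            have h2 : 0 ≤ 2 * h (x 0) * Real.sqrt (1 + deriv h (x 0) ^ 2) := by
              have := (hh.h_pos (x 0)).le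
              positivity
            nlinarith
        have hps : 0 < primeSq x := by
          have : primeSq x = h (x 0) ^ 2 := by rw [levelFn] at h0; linarith
          rw [this]
          have := hh.h_pos (x 0)
          positivity
        have : max (v x) 0 ^ 2 * m x + η * (2 * primeSq x) ≤ 0 := hxm
        nlinarith
      rcases K.eq_empty_or_nonempty with hK | hK
      · refine ⟨1, one_pos, fun x hx _ => ?_⟩
        rcases le_or_gt ‖x - ξ‖ P' with hle | hgt
        · have hnot : x ∉ K := by rw [hK]; exact notMem_empty x
          rw [radialStep_zero hP₂ hP' hle]
          by_contra hneg
          refine hnot ⟨⟨subset_closure hx, mem_closedBall_iff_norm.2 hle⟩, ?_⟩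
          change _ ≤ (0 : ℝ)
          linarith
        · exact hZpos x (subset_closure hx) hgt
      · obtain ⟨x₀, hx₀, hmin⟩ := hKc.exists_isMinOn hK (continuous_levelFn hh).continuousOn
        refine ⟨levelFn h x₀ / 2, half_pos (hpos x₀ hx₀), fun x hx hxG => ?_⟩
        rcases le_or_gt ‖x - ξ‖ P' with hle | hgt
        · have hnot : x ∉ K := fun hxK => by
            have : levelFn h x₀ ≤ levelFn h x := hmin hxK
            linarith [hpos x₀ hx₀]
          rw [radialStep_zero hP₂ hP' hle]
          by_contra hneg
          refine hnot ⟨⟨subset_closure hx, mem_closedBall_iff_norm.2 hle⟩, ?_⟩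
          change _ ≤ (0 : ℝ)
          linarith
        · exact hZpos x (subset_closure hx) hgt
    have hdiv := integral_div_le_zero hh hP₂' (Z := Z)
      (fun i => (hq.mul (hpd i)).add (contDiffOn_const.mul (hW i).contDiffOn))
      (fun i x hx hne => by
        by_contra hlt
        rw [not_le] at hlt
        refine hne ?_
        have : v x ≤ 0 := by
          by_contra hv0
          exact absurd (hsupp x hx (not_le.1 hv0)) (by linarith)
        simp only [Z, W]
        rw [max_eq_right this, radialStep_one hP₂ hP' hlt.le]
        simp)
      hε₀ (fun x hx hxG => by rw [hZG]; exact hε₀G x hx hxG)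
    have hcongr : ∀ x ∈ D, ∑ i, pdW (closure Ω) (Z i) i x =
        max (v x) 0 ^ 2 * lapW (closure Ω) v x +
          2 * max (v x) 0 * ∑ i, pdW (closure Ω) v i x ^ 2 +
          η * ∑ i, pdW (closure Ω) (W i) i x := by
      intro x hx
      have hx' : x ∈ closure Ω := subset_closure hx.1
      rw [lapW_eq, Finset.mul_sum, Finset.mul_sum, Finset.mul_sum, ← Finset.sum_add_distrib,
        ← Finset.sum_add_distrib]
      refine Finset.sum_congr rfl fun i _ => ?_
      have d1 := hq.differentiableOn (by norm_num)
      have d2 := (hpd i).differentiableOn (by norm_num)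
      have d12 : DifferentiableOn ℝ (fun y => max (v y) 0 ^ 2 * pdW (closure Ω) v i y)
        (closure Ω) := d1.mul d2
      have d3 : DifferentiableOn ℝ (W i) (closure Ω) :=
        ((hW i).differentiable (by norm_num)).differentiableOn
      simp only [Z]
      rw [pdW_add hud d12 (d3.const_mul η) i hx', pdW_mul hud d1 d2 i hx',
        pdW_const_mul hud d3 η i hx', pdW_posPart_sq hud hvd i hx']
      ring
    have i1 := integrableOn_of_continuousOn hlc ξ P
    have i2 := integrableOn_of_continuousOn hgc ξ P
    have i3 := (integrableOn_of_continuousOn hEc ξ P).const_mul η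
    have i12 : IntegrableOn (fun x => max (v x) 0 ^ 2 * lapW (closure Ω) v x +
        2 * max (v x) 0 * ∑ i, pdW (closure Ω) v i x ^ 2) D := i1.add i2
    rw [setIntegral_congr_fun hmeas hcongr, integral_add i12 i3,
      integral_add i1 i2, integral_const_mul] at hdiv
    have hnn : 0 ≤ ∫ x in D, 2 * max (v x) 0 * ∑ i, pdW (closure Ω) v i x ^ 2 :=
      integral_nonneg fun x => mul_nonneg (by positivity)
        (Finset.sum_nonneg fun i _ => sq_nonneg _)
    linarith
  set A := ∫ x in D, max (v x) 0 ^ 2 * lapW (closure Ω) v x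
  by_contra hA
  rw [not_le] at hA
  have h1 : 0 < |B| + 1 := by positivity
  have := key (A / (2 * (|B| + 1))) (by positivity)
  have h2 : A / (2 * (|B| + 1)) * B ≥ -(A / 2) := by
    have : A / (2 * (|B| + 1)) * (|B| + 1) = A / 2 := by field_simp
    have h3 : 0 < A / (2 * (|B| + 1)) := by positivity
    nlinarith [neg_abs_le B]
  linarith

end green

/-! ### Compactly supported subsolutions and the cubic energy -/

section energy

variable {d : ℕ} {R α L : ℝ} {h f : ℝ → ℝ} {c K : ℝ} {φ : ℝ → ℝ} {u : ℝ → Euc d → ℝ}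
  {ξ : Euc d} {P : ℝ}

/-- A subsolution `z` on `[a, b]` with time derivative `dz`, whose positivity set stays inside
a ball around `ξ` of radius smaller than `P`; the differential inequality is only required where
`z` exceeds `u`. -/
structure IsTest (h f : ℝ → ℝ) (u : ℝ → Euc d → ℝ) (ξ : Euc d) (P a b : ℝ)
    (z dz : ℝ → Euc d → ℝ) : Prop where
  supp : ∃ P', 0 ≤ P' ∧ P' < P ∧
    ∀ t ∈ Icc a b, ∀ x ∈ closure (funnel d h), 0 < z t x → ‖x - ξ‖ ≤ P'
  lip : ∃ C, ∀ s ∈ Icc a b, ∀ t ∈ Icc a b, ∀ x ∈ closure (funnel d h),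
    |z s x - z t x| ≤ C * |s - t|
  le_one : ∀ t ∈ Icc a b, ∀ x ∈ closure (funnel d h), z t x ≤ 1
  reg : ∀ t ∈ Icc a b, ContDiffOn ℝ 2 (z t) (closure (funnel d h))
  time : ∀ t ∈ Ico a b, ∀ x ∈ funnel d h, HasDerivAt (fun s => z s x) (dz t x) t
  sub : ∀ t ∈ Ico a b, ∀ x ∈ funnel d h, u t x < z t x →
    dz t x ≤ lapW (closure (funnel d h)) (z t) x + f (z t x)
  neumann : ∀ t ∈ Ico a b, ∀ x ∈ frontier (funnel d h), 0 < z t x → neumannLHS h (z t) x ≤ 0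

/-- The cubic energy of the positive part of `z - u`. -/
def energy (h : ℝ → ℝ) (u : ℝ → Euc d → ℝ) (ξ : Euc d) (P : ℝ) (z : ℝ → Euc d → ℝ)
    (t : ℝ) : ℝ :=
  ∫ x in funnel d h ∩ Metric.ball ξ P, max (z t x - u t x) 0 ^ 3

/-- At time `t`, the energy of every subsolution obeys the Grönwall differential inequality. -/
def GoodTime (h f : ℝ → ℝ) (u : ℝ → Euc d → ℝ) (ξ : Euc d) (P K t : ℝ) : Prop :=
  ∀ a b z dz, IsTest h f u ξ P a b z dz → t ∈ Ico a b → ∀ r, 3 * K * energy h u ξ P z t < r →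
    ∀ᶠ s in 𝓝[>] t, (s - t)⁻¹ * (energy h u ξ P z s - energy h u ξ P z t) < r

lemma energy_nonneg (z : ℝ → Euc d → ℝ) (t : ℝ) : 0 ≤ energy h u ξ P z t :=
  integral_nonneg fun x => by positivity

lemma continuousOn_energy_integrand (hu : IsEntireSolution d h f c φ u) {a b : ℝ}
    {z dz : ℝ → Euc d → ℝ} (hz : IsTest h f u ξ P a b z dz) {t : ℝ} (ht : t ∈ Icc a b) (n : ℕ) :
    ContinuousOn (fun x => max (z t x - u t x) 0 ^ n) (closure (funnel d h)) :=
  (((hz.reg t ht).continuousOn.sub (hu.space_reg t).continuousOn).sup continuousOn_const).pow n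

lemma continuousOn_energy (hh : IsFunnel d R α L h) (hu : IsEntireSolution d h f c φ u) {a b : ℝ}
    {z dz : ℝ → Euc d → ℝ} (hz : IsTest h f u ξ P a b z dz) :
    ContinuousOn (energy h u ξ P z) (Icc a b) := by
  have hmeas : MeasurableSet (funnel d h ∩ Metric.ball ξ P) :=
    (hh.isOpen_funnel.inter Metric.isOpen_ball).measurableSet
  refine continuousOn_of_dominated (bound := fun _ => 1) ?_ ?_ ?_ ?_
  · intro t ht
    exact (integrableOn_of_continuousOn
      (continuousOn_energy_integrand hu hz ht 3) ξ P).aestronglyMeasurable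
  · intro t ht
    refine (ae_restrict_iff' hmeas).2 (ae_of_all _ fun x hx => ?_)
    have hx' := subset_closure hx.1
    rw [norm_pow, Real.norm_of_nonneg (le_max_right _ _)]
    refine pow_le_one₀ (le_max_right _ _) (max_le ?_ zero_le_one)
    linarith [(hu.range01 t x hx').1, hz.le_one t ht x hx']
  · exact integrableOn_of_continuousOn continuousOn_const ξ P
  · refine (ae_restrict_iff' hmeas).2 (ae_of_all _ fun x hx => ?_)
    have hx' := subset_closure hx.1
    obtain ⟨C, hC⟩ := hz.lip
    have h1 : ContinuousOn (fun t => z t x) (Icc a b) := by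
      refine LipschitzOnWith.continuousOn (K := Real.toNNReal C) ?_
      refine LipschitzOnWith.of_dist_le_mul fun s hs t ht => ?_
      rw [Real.dist_eq, Real.dist_eq]
      exact (hC s hs t ht x hx').trans
        (mul_le_mul_of_nonneg_right (Real.le_coe_toNNReal C) (abs_nonneg _))
    exact ((h1.sub (hu.time_diff x hx').continuous.continuousOn).sup continuousOn_const).pow 3

lemma posPart_cube_sub_le (a b : ℝ) :
    max b 0 ^ 3 - max a 0 ^ 3 ≤ 3 * max b 0 ^ 2 * (b - a) := by
  rcases le_total b 0 with hb | hb <;> rcases le_total a 0 with ha | ha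
  · simp [ha, hb]
  · simp only [hb, ha, max_eq_left, max_eq_right]
    have : 0 ≤ a ^ 3 := by positivity
    linarith
  · simp only [hb, ha, max_eq_left, max_eq_right]
    have h1 : 0 ≤ b ^ 3 := by positivity
    have h2 : 0 ≤ b ^ 2 * (-a) := mul_nonneg (by positivity) (by linarith)
    nlinarith
  · simp only [hb, ha, max_eq_left]
    have : 0 ≤ (b - a) ^ 2 * (2 * b + a) := by positivity
    nlinarith

theorem goodTime_of_lower_bound (hh : IsFunnel d R α L h) (hu : IsEntireSolution d h f c φ u)
    (hK : ∀ a ∈ Icc (0 : ℝ) 1, ∀ b ∈ Icc (0 : ℝ) 1, |f a - f b| ≤ K * |a - b|) {t : ℝ}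
    (hlow : ∀ P', 0 ≤ P' → P' < P → ∃ δ > 0, ∃ C, ∀ s ∈ Ioo t (t + δ), ∀ x ∈ funnel d h,
      ‖x - ξ‖ ≤ P' → -(C * (s - t)) ≤ u s x - u t x) :
    GoodTime h f u ξ P K t := by
  intro a b z dz hz ht r hr
  set Ω := funnel d h with hΩ
  set D := Ω ∩ Metric.ball ξ P with hD
  have hmeas : MeasurableSet D := (hh.isOpen_funnel.inter Metric.isOpen_ball).measurableSet
  have ht' : t ∈ Icc a b := Ico_subset_Icc_self ht
  have hud : UniqueDiffOn ℝ (closure Ω) := hh.uniqueDiffOn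
  obtain ⟨P', hP'0, hP'P, hsupp⟩ := hz.supp
  obtain ⟨Cz, hCz⟩ := hz.lip
  obtain ⟨δ, hδ, Cu, hCu⟩ := hlow P' hP'0 hP'P
  set v : Euc d → ℝ := fun x => z t x - u t x with hv
  have hvc : ContDiffOn ℝ 2 v (closure Ω) := (hz.reg t ht').sub (hu.space_reg t)
  have hlapv : ∀ x ∈ closure Ω, lapW (closure Ω) v x =
      lapW (closure Ω) (z t) x - lapW (closure Ω) (u t) x := fun x hx =>
    lapW_sub hud (hz.reg t ht') (hu.space_reg t) hx
  set J : Euc d → ℝ := fun x =>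
    3 * (max (v x) 0 ^ 2 * lapW (closure Ω) v x) + 3 * K * max (v x) 0 ^ 3 with hJ
  have hc2 : ContinuousOn (fun x => max (v x) 0 ^ 2 * lapW (closure Ω) v x) (closure Ω) :=
    (continuousOn_energy_integrand hu hz ht' 2).mul (continuousOn_lapW hud hvc)
  have hc3 : ContinuousOn (fun x => max (v x) 0 ^ 3) (closure Ω) :=
    continuousOn_energy_integrand hu hz ht' 3
  have hJc : ContinuousOn J (closure Ω) :=
    (continuousOn_const.mul hc2).add (continuousOn_const.mul hc3)
  have hJi := integrableOn_of_continuousOn hJc ξ P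
  -- the difference quotient, truncated from below
  set g : ℝ → Euc d → ℝ := fun s x => max (3 * max (z s x - u s x) 0 ^ 2 *
    ((s - t)⁻¹ * ((z s x - u s x) - (z t x - u t x)))) (J x) with hg
  have hgc : ∀ s ∈ Icc a b, ContinuousOn (g s) (closure Ω) := fun s hs' =>
    ContinuousOn.sup (ContinuousOn.mul (continuousOn_const.mul
      (continuousOn_energy_integrand hu hz hs' 2)) (continuousOn_const.mul
        (((hz.reg s hs').continuousOn.sub (hu.space_reg s).continuousOn).sub hvc.continuousOn)))
        hJc
  have hnear : ∀ᶠ s in 𝓝[>] t, s ∈ Ioo t (min b (t + δ)) :=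
    Ioo_mem_nhdsGT (lt_min ht.2 (by linarith))
  have hlim : Tendsto (fun s => ∫ x in D, g s x) (𝓝[>] t) (𝓝 (∫ x in D, J x)) := by
    refine tendsto_integral_filter_of_dominated_convergence
      (fun x => 3 * (|Cz| + |Cu|) + ‖J x‖) ?_ ?_ ?_ ?_
    · filter_upwards [hnear] with s hs
      have hs' : s ∈ Icc a b := ⟨ht.1.trans hs.1.le, hs.2.le.trans (min_le_left _ _)⟩
      exact (integrableOn_of_continuousOn (hgc s hs') ξ P).aestronglyMeasurable
    · filter_upwards [hnear] with s hs
      have hs' : s ∈ Icc a b := ⟨ht.1.trans hs.1.le, hs.2.le.trans (min_le_left _ _)⟩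
      have hst : 0 < s - t := sub_pos.2 hs.1
      refine (ae_restrict_iff' hmeas).2 (ae_of_all _ fun x hx => ?_)
      have hx' := subset_closure hx.1
      have hnn : 0 ≤ |Cz| + |Cu| := by positivity
      have hup : 3 * max (z s x - u s x) 0 ^ 2 *
          ((s - t)⁻¹ * ((z s x - u s x) - (z t x - u t x))) ≤ 3 * (|Cz| + |Cu|) := by
        rcases le_or_gt (z s x - u s x) 0 with hle | hgt
        · rw [max_eq_right hle]
          simp only [ne_eq, OfNat.ofNat_ne_zero, not_false_eq_true, zero_pow, mul_zero, zero_mul]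
          positivity
        · have hu0 := (hu.range01 s x hx').1
          have hz1 := hz.le_one s hs' x hx'
          have hxP : ‖x - ξ‖ ≤ P' := hsupp s hs' x hx' (by linarith)
          have e1 := hCu s ⟨hs.1, hs.2.trans_le (min_le_right _ _)⟩ x hx.1 hxP
          have e2 := (le_abs_self _).trans (hCz s hs' t ht' x hx')
          rw [abs_of_pos hst] at e2
          have e3 : (s - t)⁻¹ * ((z s x - u s x) - (z t x - u t x)) ≤ |Cz| + |Cu| := by
            rw [inv_mul_le_iff₀ hst]
            nlinarith [le_abs_self Cz, le_abs_self Cu]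
          rw [max_eq_left hgt.le]
          have e5 : (z s x - u s x) ^ 2 ≤ 1 := by nlinarith
          calc _ ≤ 3 * (z s x - u s x) ^ 2 * (|Cz| + |Cu|) :=
                mul_le_mul_of_nonneg_left e3 (by positivity)
            _ ≤ _ := mul_le_mul_of_nonneg_right (by linarith) hnn
      rw [Real.norm_eq_abs, abs_le]
      constructor
      · refine le_max_of_le_right ?_
        linarith [neg_abs_le (J x), Real.norm_eq_abs (J x)]
      · refine max_le (by linarith [norm_nonneg (J x)]) ?_
        linarith [le_abs_self (J x), Real.norm_eq_abs (J x)]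
    · exact (integrableOn_of_continuousOn continuousOn_const ξ P).add hJi.norm
    · refine (ae_restrict_iff' hmeas).2 (ae_of_all _ fun x hx => ?_)
      have hx' := subset_closure hx.1
      have hder : HasDerivAt (fun s => z s x - u s x)
          (dz t x - deriv (fun s => u s x) t) t :=
        (hz.time t ht x hx.1).fun_sub (hu.time_diff x hx' t).hasDerivAt
      have h1 : Tendsto (fun s => z s x - u s x) (𝓝[>] t) (𝓝 (v x)) :=
        hder.continuousAt.tendsto.mono_left nhdsWithin_le_nhds
      have h2 : Tendsto (fun s => (s - t)⁻¹ * ((z s x - u s x) - (z t x - u t x))) (𝓝[>] t)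
          (𝓝 (dz t x - deriv (fun s => u s x) t)) := by
        have := hder.tendsto_slope.mono_left
          (nhdsWithin_mono t (fun s (hs : t < s) => hs.ne' : Ioi t ⊆ {t}ᶜ))
        refine this.congr fun s => ?_
        rw [slope_def_field, div_eq_inv_mul]
      have h3 := ((((h1.max (tendsto_const_nhds (x := (0 : ℝ)))).pow 2).const_mul 3).mul h2).max
        (tendsto_const_nhds (x := J x))
      have h4 : 3 * max (v x) 0 ^ 2 * (dz t x - deriv (fun s => u s x) t) ≤ J x := by
        rcases le_or_gt (v x) 0 with hle | hgt
        · simp only [hJ, max_eq_right hle]; simp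
        · have hzu : u t x < z t x := by simp only [hv] at hgt; linarith
          have hu01 := hu.range01 t x hx'
          have hz1 := hz.le_one t ht' x hx'
          have e1 := hz.sub t ht x hx.1 hzu
          have e2 := (le_abs_self _).trans (hK (z t x) ⟨by linarith [hu01.1], hz1⟩ (u t x) hu01)
          rw [abs_of_pos (by linarith)] at e2
          have e3 := hu.pde t x hx'
          have e4 : dz t x - deriv (fun s => u s x) t ≤ lapW (closure Ω) v x + K * v x := by
            rw [hlapv x hx', e3]; simp only [hv]; linarith
          simp only [hJ, max_eq_left hgt.le]
          calc _ ≤ 3 * v x ^ 2 * (lapW (closure Ω) v x + K * v x) :=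
                mul_le_mul_of_nonneg_left e4 (by positivity)
            _ = _ := by ring
      rwa [max_eq_right h4] at h3
  have hI : ∫ x in D, J x ≤ 3 * K * energy h u ξ P z t := by
    have hgreen : ∫ x in D, max (v x) 0 ^ 2 * lapW (closure Ω) v x ≤ 0 := by
      refine integral_posPart_sq_mul_lapW_le hh hP'0 hP'P hvc ?_ ?_
      · intro x hx hvx
        refine hsupp t ht' x hx ?_
        have := (hu.range01 t x hx).1
        simp only [hv] at hvx
        linarith
      · intro x hx hvx
        have hx' := frontier_subset_closure hx
        rw [hv, neumannLHS_sub hud ((hz.reg t ht').differentiableOn (by norm_num))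
          ((hu.space_reg t).differentiableOn (by norm_num)) hx', hu.neumann t x hx, sub_zero]
        refine hz.neumann t ht x hx ?_
        have := (hu.range01 t x hx').1
        simp only [hv] at hvx
        linarith
    have hi1 := (integrableOn_of_continuousOn hc2 ξ P).const_mul 3
    have hi2 := (integrableOn_of_continuousOn hc3 ξ P).const_mul (3 * K)
    have e : ∫ x in D, J x = 3 * (∫ x in D, max (v x) 0 ^ 2 * lapW (closure Ω) v x) +
        3 * K * energy h u ξ P z t := by
      rw [hJ, integral_add hi1 hi2, integral_const_mul, integral_const_mul]; rfl
    linarith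
  have hev := hlim.eventually_lt_const (hI.trans_lt hr)
  filter_upwards [hev, hnear] with s hs1 hs
  have hs' : s ∈ Icc a b := ⟨ht.1.trans hs.1.le, hs.2.le.trans (min_le_left _ _)⟩
  have hst : 0 < s - t := sub_pos.2 hs.1
  refine lt_of_le_of_lt ?_ hs1
  have j1 := integrableOn_of_continuousOn (continuousOn_energy_integrand hu hz hs' 3) ξ P
  have j2 := integrableOn_of_continuousOn (continuousOn_energy_integrand hu hz ht' 3) ξ P
  rw [energy, energy, ← integral_sub j1 j2, ← integral_const_mul]
  refine integral_mono ((j1.sub j2).const_mul _)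
    (integrableOn_of_continuousOn (hgc s hs') ξ P) fun x => ?_
  have := posPart_cube_sub_le (z t x - u t x) (z s x - u s x)
  calc _ ≤ (s - t)⁻¹ * (3 * max (z s x - u s x) 0 ^ 2 *
          ((z s x - u s x) - (z t x - u t x))) :=
        mul_le_mul_of_nonneg_left this (by positivity)
    _ = 3 * max (z s x - u s x) 0 ^ 2 *
          ((s - t)⁻¹ * ((z s x - u s x) - (z t x - u t x))) := by ring
    _ ≤ _ := le_max_left _ _

theorem le_of_goodTime (hh : IsFunnel d R α L h) (hu : IsEntireSolution d h f c φ u) {a b : ℝ}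
    {z dz : ℝ → Euc d → ℝ} (hz : IsTest h f u ξ P a b z dz)
    (hgood : ∀ t ∈ Ioo a b, GoodTime h f u ξ P K t)
    (hstart : ∀ x ∈ closure (funnel d h), z a x ≤ u a x) :
    ∀ t ∈ Icc a b, ∀ x ∈ closure (funnel d h), z t x ≤ u t x := by
  have hDo : IsOpen (funnel d h ∩ Metric.ball ξ P) := hh.isOpen_funnel.inter Metric.isOpen_ball
  have hmeas : MeasurableSet (funnel d h ∩ Metric.ball ξ P) := hDo.measurableSet
  set F := energy h u ξ P z with hF
  have hFc : ContinuousOn F (Icc a b) := continuousOn_energy hh hu hz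
  have hFa : F a = 0 := by
    rw [hF, energy]
    refine setIntegral_eq_zero_of_forall_eq_zero fun x hx => ?_
    rw [max_eq_right (by linarith [hstart x (subset_closure hx.1)])]
    norm_num
  have hF0 : ∀ t ∈ Ioc a b, F t ≤ 0 := by
    rintro t ⟨hat, htb⟩
    have hgron : ∀ a' ∈ Ioo a t, F t ≤ F a' * Real.exp (3 * K * (t - a')) := by
      intro a' ha'
      have := le_gronwallBound_of_liminf_deriv_right_le (f := F) (f' := fun s => 3 * K * F s)
        (δ := F a') (K := 3 * K) (ε := 0) (a := a') (b := t)
        (hFc.mono (Icc_subset_Icc ha'.1.le htb)) ?_ le_rfl (fun x _ => by simp) t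
        ⟨ha'.2.le, le_rfl⟩
      · rwa [gronwallBound_ε0] at this
      · intro s hs r hr
        exact (hgood s ⟨ha'.1.trans_le hs.1, hs.2.trans_le htb⟩ a b z dz hz
          ⟨ha'.1.le.trans hs.1, hs.2.trans_le htb⟩ r hr).frequently
    have hl : Tendsto (fun a' => F a' * Real.exp (3 * K * (t - a'))) (𝓝[>] a)
        (𝓝 (F a * Real.exp (3 * K * (t - a)))) := by
      refine Tendsto.mul ?_ ?_
      · have := hFc a ⟨le_rfl, hat.le.trans htb⟩
        refine this.mono_left ?_
        rw [← nhdsWithin_Ioo_eq_nhdsGT (hat.trans_le htb)]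
        exact nhdsWithin_mono _ Ioo_subset_Icc_self
      · refine Tendsto.mono_left (Continuous.tendsto ?_ a) nhdsWithin_le_nhds
        fun_prop
    rw [hFa, zero_mul] at hl
    refine ge_of_tendsto hl ?_
    filter_upwards [Ioo_mem_nhdsGT hat] with a' ha' using hgron a' ha'
  intro t ht
  rcases ht.1.eq_or_lt with rfl | hat
  · exact hstart
  have hFt : F t = 0 := le_antisymm (hF0 t ⟨hat, ht.2⟩) (energy_nonneg z t)
  have hΩ : ∀ x ∈ funnel d h, z t x ≤ u t x := by
    intro x hx
    by_cases hxP : x ∈ Metric.ball ξ P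
    · have hc := continuousOn_energy_integrand hu hz ht 3
      have hae : (fun x => max (z t x - u t x) 0 ^ 3)
          =ᵐ[volume.restrict (funnel d h ∩ Metric.ball ξ P)] fun _ => 0 := by
        rw [hF, energy, integral_eq_zero_iff_of_nonneg (fun x => by positivity)
          (integrableOn_of_continuousOn hc ξ P)] at hFt
        exact hFt
      have := Measure.eqOn_open_of_ae_eq hae hDo
        (hc.mono fun y hy => subset_closure hy.1) continuousOn_const ⟨hx, hxP⟩
      have h0 : max (z t x - u t x) 0 = 0 := by simpa using this
      linarith [le_max_left (z t x - u t x) 0]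
    · obtain ⟨P', -, hP'P, hsupp⟩ := hz.supp
      have : z t x ≤ 0 := by
        by_contra hlt
        exact hxP (mem_ball_iff_norm.2
          ((hsupp t ht x (subset_closure hx) (not_le.1 hlt)).trans_lt hP'P))
      exact this.trans (hu.range01 t x (subset_closure hx)).1
  intro x hx
  exact le_on_closure hΩ (hz.reg t ht).continuousOn (hu.space_reg t).continuousOn hx

end energy

/-! ### Second differences -/

section secondDifferences

lemma secondDiff_le {ρ M : ℝ} (hρ : 0 ≤ ρ) {g g' g'' : ℝ → ℝ}
    (h1 : ∀ τ ∈ Icc (-ρ) ρ, HasDerivAt g (g' τ) τ)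
    (h2 : ∀ τ ∈ Icc (-ρ) ρ, HasDerivAt g' (g'' τ) τ) (hM : ∀ τ ∈ Icc (-ρ) ρ, g'' τ ≤ M) :
    g ρ + g (-ρ) - 2 * g 0 ≤ M * ρ ^ 2 := by
  have hconc : ConcaveOn ℝ (Icc (-ρ) ρ) fun τ => g τ - M / 2 * τ ^ 2 := by
    refine concaveOn_of_hasDerivWithinAt2_nonpos (f' := fun τ => g' τ - M * τ)
      (f'' := fun τ => g'' τ - M) (convex_Icc _ _) ?_ ?_ ?_ ?_
    · intro τ hτ
      exact ((h1 τ hτ).continuousAt.sub (by fun_prop)).continuousWithinAt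
    · intro τ hτ
      have := (h1 τ (interior_subset hτ)).fun_sub ((hasDerivAt_pow 2 τ).const_mul (M / 2))
      refine HasDerivAt.hasDerivWithinAt ?_
      convert this using 1
      norm_num
      ring
    · intro τ hτ
      have := (h2 τ (interior_subset hτ)).fun_sub ((hasDerivAt_id τ).const_mul M)
      refine HasDerivAt.hasDerivWithinAt ?_
      simpa using this
    · intro τ hτ
      linarith [hM τ (interior_subset hτ)]
  have := hconc.2 (⟨by linarith, le_rfl⟩ : ρ ∈ Icc (-ρ) ρ)
    (⟨le_rfl, by linarith⟩ : -ρ ∈ Icc (-ρ) ρ) (by norm_num : (0 : ℝ) ≤ 1 / 2)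
    (by norm_num : (0 : ℝ) ≤ 1 / 2) (by norm_num)
  simp only [smul_eq_mul] at this
  have e : 1 / 2 * ρ + 1 / 2 * -ρ = 0 := by ring
  rw [e] at this
  nlinarith

variable {d : ℕ} {R α L : ℝ} {h f : ℝ → ℝ}

lemma hasDerivAt_line (hh : IsFunnel d R α L h) {v : Euc d → ℝ}
    (hv : DifferentiableOn ℝ v (closure (funnel d h))) (x : Euc d) (i : Fin (d + 1)) {τ : ℝ}
    (hx : x + τ • EuclideanSpace.single i (1 : ℝ) ∈ funnel d h) :
    HasDerivAt (fun τ : ℝ => v (x + τ • EuclideanSpace.single i (1 : ℝ)))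
      (pdW (closure (funnel d h)) v i (x + τ • EuclideanSpace.single i (1 : ℝ))) τ := by
  have hline : HasDerivAt (fun τ : ℝ => x + τ • (EuclideanSpace.single i (1 : ℝ) : Euc d))
      (EuclideanSpace.single i (1 : ℝ)) τ := by
    simpa using ((hasDerivAt_id τ).smul_const (EuclideanSpace.single i (1 : ℝ) : Euc d)).const_add x
  rw [pdW_eq_fderiv hh hx]
  have hd : DifferentiableAt ℝ v (x + τ • EuclideanSpace.single i (1 : ℝ)) :=
    hv.differentiableAt (mem_of_superset (hh.isOpen_funnel.mem_nhds hx) subset_closure)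
  exact hd.hasFDerivAt.comp_hasDerivAt τ hline

/-- The sum over the coordinate directions of the second differences of `v` with step `ρ`. -/
def secondDiff (v : Euc d → ℝ) (x : Euc d) (ρ : ℝ) : ℝ :=
  ∑ i, (v (x + ρ • EuclideanSpace.single i (1 : ℝ)) +
    v (x + (-ρ) • EuclideanSpace.single i (1 : ℝ)) - 2 * v x)

lemma line_mem_closedBall {x : Euc d} {ρ τ : ℝ} (hτ : τ ∈ Icc (-ρ) ρ) (i : Fin (d + 1)) :
    x + τ • EuclideanSpace.single i (1 : ℝ) ∈ Metric.closedBall x ρ := by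
  rw [mem_closedBall_iff_norm, add_sub_cancel_left, norm_smul]
  simpa using abs_le.2 hτ

lemma secondDiff_le_of_pdW_le (hh : IsFunnel d R α L h) {v : Euc d → ℝ}
    (hv : ContDiffOn ℝ 2 v (closure (funnel d h))) {x : Euc d} {ρ : ℝ} (hρ : 0 ≤ ρ)
    (hball : Metric.closedBall x ρ ⊆ funnel d h) {M : Fin (d + 1) → ℝ}
    (hM : ∀ i, ∀ y ∈ Metric.closedBall x ρ,
      pdW (closure (funnel d h)) (pdW (closure (funnel d h)) v i) i y ≤ M i) :
    secondDiff v x ρ ≤ (∑ i, M i) * ρ ^ 2 := by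
  rw [secondDiff, Finset.sum_mul]
  refine Finset.sum_le_sum fun i _ => ?_
  have := secondDiff_le hρ
    (fun τ hτ => hasDerivAt_line hh (hv.differentiableOn (by norm_num)) x i
      (hball (line_mem_closedBall hτ i)))
    (fun τ hτ => hasDerivAt_line hh
      ((contDiffOn_pdW (n := 1) hh.uniqueDiffOn (by exact_mod_cast hv) i).differentiableOn
        (by norm_num)) x i (hball (line_mem_closedBall hτ i)))
    (fun τ hτ => hM i _ (line_mem_closedBall hτ i))
  simpa using this

lemma le_secondDiff_of_le_pdW (hh : IsFunnel d R α L h) {v : Euc d → ℝ}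
    (hv : ContDiffOn ℝ 2 v (closure (funnel d h))) {x : Euc d} {ρ : ℝ} (hρ : 0 ≤ ρ)
    (hball : Metric.closedBall x ρ ⊆ funnel d h) {m : Fin (d + 1) → ℝ}
    (hm : ∀ i, ∀ y ∈ Metric.closedBall x ρ,
      m i ≤ pdW (closure (funnel d h)) (pdW (closure (funnel d h)) v i) i y) :
    (∑ i, m i) * ρ ^ 2 ≤ secondDiff v x ρ := by
  rw [secondDiff, Finset.sum_mul]
  refine Finset.sum_le_sum fun i _ => ?_
  have := secondDiff_le (M := -m i) hρ
    (fun τ hτ => (hasDerivAt_line hh (hv.differentiableOn (by norm_num)) x i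
      (hball (line_mem_closedBall hτ i))).neg)
    (fun τ hτ => (hasDerivAt_line hh
      ((contDiffOn_pdW (n := 1) hh.uniqueDiffOn (by exact_mod_cast hv) i).differentiableOn
        (by norm_num)) x i (hball (line_mem_closedBall hτ i))).neg)
    (fun τ hτ => neg_le_neg (hm i _ (line_mem_closedBall hτ i)))
  simp only [Pi.neg_apply, zero_smul, add_zero] at this
  linarith

lemma abs_lapW_le_of_secondDiff (hh : IsFunnel d R α L h) {v : Euc d → ℝ}
    (hv : ContDiffOn ℝ 2 v (closure (funnel d h))) {O : Set (Euc d)} (hO : IsOpen O)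
    (hOΩ : O ⊆ funnel d h) {n : ℝ}
    (hn : ∀ x, ∀ ρ > 0, Metric.closedBall x ρ ⊆ O → |secondDiff v x ρ| ≤ n * ρ ^ 2)
    {x : Euc d} (hx : x ∈ O) : |lapW (closure (funnel d h)) v x| ≤ n := by
  set Λ : Fin (d + 1) → Euc d → ℝ := fun i =>
    pdW (closure (funnel d h)) (pdW (closure (funnel d h)) v i) i with hΛ
  have hcont : ∀ i, ContinuousAt (Λ i) x := fun i =>
    (continuousOn_pdW_pdW hh.uniqueDiffOn hv i i).continuousAt
      (mem_of_superset (hh.isOpen_funnel.mem_nhds (hOΩ hx)) subset_closure)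
  have key : ∀ η > 0, ∃ ρ > 0, Metric.closedBall x ρ ⊆ O ∧
      ∀ i, ∀ y ∈ Metric.closedBall x ρ, |Λ i y - Λ i x| ≤ η := by
    intro η hη
    have hev : ∀ᶠ y in 𝓝 x, y ∈ O ∧ ∀ i, |Λ i y - Λ i x| ≤ η := by
      refine (show ∀ᶠ y in 𝓝 x, y ∈ O from hO.mem_nhds hx).and (eventually_all.2 fun i => ?_)
      filter_upwards [Metric.tendsto_nhds.1 (hcont i) η hη] with y hy
      rw [Real.dist_eq] at hy
      exact hy.le
    obtain ⟨ρ, hρ, hb⟩ := Metric.nhds_basis_closedBall.mem_iff.1 hev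
    exact ⟨ρ, hρ, fun y hy => (hb hy).1, fun i y hy => (hb hy).2 i⟩
  have hbound : ∀ η > 0, |lapW (closure (funnel d h)) v x| ≤ n + (d + 1) * η := by
    intro η hη
    obtain ⟨ρ, hρ, hb, hΛb⟩ := key η hη
    have h0 := abs_le.1 (hn x ρ hρ hb)
    have h1 := secondDiff_le_of_pdW_le hh hv hρ.le (hb.trans hOΩ) (M := fun i => Λ i x + η)
      (fun i y hy => by have := abs_le.1 (hΛb i y hy); change Λ i y ≤ _; linarith)
    have h2 := le_secondDiff_of_le_pdW hh hv hρ.le (hb.trans hOΩ) (m := fun i => Λ i x - η)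
      (fun i y hy => by have := abs_le.1 (hΛb i y hy); change _ ≤ Λ i y; linarith)
    rw [Finset.sum_add_distrib] at h1
    rw [Finset.sum_sub_distrib] at h2
    simp only [Finset.sum_const, Finset.card_univ, Fintype.card_fin, nsmul_eq_mul, Nat.cast_add,
      Nat.cast_one] at h1 h2
    have e : lapW (closure (funnel d h)) v x = ∑ i, Λ i x := rfl
    have hρ2 : 0 < ρ ^ 2 := by positivity
    rw [e, abs_le]
    constructor
    · have : (-n) * ρ ^ 2 ≤ (∑ i, Λ i x + (d + 1) * η) * ρ ^ 2 := by linarith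
      have := le_of_mul_le_mul_right this hρ2
      linarith
    · have : (∑ i, Λ i x - (d + 1) * η) * ρ ^ 2 ≤ n * ρ ^ 2 := by linarith
      have := le_of_mul_le_mul_right this hρ2
      linarith
  refine le_of_forall_pos_le_add fun ε hε => ?_
  have := hbound (ε / (d + 1)) (by positivity)
  rwa [mul_div_cancel₀ _ (by positivity)] at this

/-- Bounds on the Laplacian that pass to closed sets of times. -/
lemma exists_closed_cover (hh : IsFunnel d R α L h) {u : ℝ → Euc d → ℝ}
    (hreg : ∀ t, ContDiffOn ℝ 2 (u t) (closure (funnel d h)))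
    (htime : ∀ x ∈ closure (funnel d h), Continuous fun t => u t x) (ξ : Euc d) (P : ℝ) :
    ∃ A : ℕ → Set ℝ, (∀ n, IsClosed (A n)) ∧ (⋃ n, A n) = univ ∧
      ∀ n, ∀ t ∈ A n, ∀ x ∈ funnel d h ∩ Metric.ball ξ P,
        |lapW (closure (funnel d h)) (u t) x| ≤ n := by
  set D := funnel d h ∩ Metric.ball ξ P with hD
  have hDΩ : D ⊆ funnel d h := inter_subset_left
  refine ⟨fun n => {t | ∀ x, ∀ ρ > 0, Metric.closedBall x ρ ⊆ D →
    |secondDiff (u t) x ρ| ≤ n * ρ ^ 2}, fun n => ?_, ?_, fun n t ht x hx => ?_⟩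
  · simp only [Set.ofPred_forall]
    refine isClosed_iInter fun x => isClosed_iInter fun ρ => isClosed_iInter fun hρ =>
      isClosed_iInter fun hb => ?_
    refine isClosed_le (Continuous.abs ?_) continuous_const
    have hmem : ∀ τ ∈ Icc (-ρ) ρ, ∀ i,
        Continuous fun t => u t (x + τ • EuclideanSpace.single i (1 : ℝ)) := fun τ hτ i =>
      htime _ (subset_closure (hDΩ (hb (line_mem_closedBall hτ i))))
    refine continuous_finsetSum _ fun i _ => ((hmem _ ⟨by linarith, le_rfl⟩ i).add
      (hmem _ ⟨le_rfl, by linarith⟩ i)).sub (continuous_const.mul ?_)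
    exact htime _ (subset_closure (hDΩ (hb (Metric.mem_closedBall_self hρ.le))))
  · rw [eq_univ_iff_forall]
    intro t
    have hbd : ∀ i, ∃ M, ∀ y ∈ closure (funnel d h) ∩ Metric.closedBall ξ P,
        ‖pdW (closure (funnel d h)) (pdW (closure (funnel d h)) (u t) i) i y‖ ≤ M := fun i =>
      (isCompact_closure_inter h ξ P).exists_bound_of_continuousOn
        ((continuousOn_pdW_pdW hh.uniqueDiffOn (hreg t) i i).mono inter_subset_left)
    choose M hM using hbd
    obtain ⟨n, hn⟩ := exists_nat_ge (∑ i, M i)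
    refine mem_iUnion.2 ⟨n, fun x ρ hρ hb => ?_⟩
    have hsub : ∀ y ∈ Metric.closedBall x ρ,
        y ∈ closure (funnel d h) ∩ Metric.closedBall ξ P := fun y hy =>
      ⟨subset_closure (hb hy).1, Metric.ball_subset_closedBall (hb hy).2⟩
    have h1 := secondDiff_le_of_pdW_le hh (hreg t) hρ.le (hb.trans hDΩ) (M := M)
      (fun i y hy => (le_abs_self _).trans (hM i y (hsub y hy)))
    have h2 := le_secondDiff_of_le_pdW hh (hreg t) hρ.le (hb.trans hDΩ) (m := fun i => -M i)
      (fun i y hy => (abs_le.1 (hM i y (hsub y hy))).1)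
    rw [Finset.sum_neg_distrib] at h2
    have : (∑ i, M i) * ρ ^ 2 ≤ n * ρ ^ 2 := mul_le_mul_of_nonneg_right hn (by positivity)
    rw [abs_le]
    constructor <;> linarith
  · exact abs_lapW_le_of_secondDiff hh (hreg t) (hh.isOpen_funnel.inter Metric.isOpen_ball)
      hDΩ ht hx

end secondDifferences

/-! ### The comparison principle -/

section comparison

variable {d : ℕ} {R α L : ℝ} {h f : ℝ → ℝ} {c K Mf : ℝ} {φ : ℝ → ℝ} {u : ℝ → Euc d → ℝ}

lemma neumannLHS_radialStep_nonneg (hh : IsFunnel d R α L h) {a b : ℝ} (hab : a < b) (ha : 0 ≤ a)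
    {x : Euc d} (hx : x ∈ frontier (funnel d h)) :
    0 ≤ neumannLHS h (radialStep (axisPt d (L * Real.cos α)) a b) x := by
  have hpos : 0 < b ^ 2 - a ^ 2 := by nlinarith
  set Ψ : ℝ → ℝ := fun r => Real.smoothTransition ((r - a ^ 2) / (b ^ 2 - a ^ 2)) with hΨ
  have hdiff : Differentiable ℝ Ψ :=
    (Real.smoothTransition.contDiff (n := 1)).differentiable (by norm_num) |>.comp
      ((differentiable_id.sub_const _).div_const _)
  have hmono : Monotone Ψ := fun r s hrs => Real.smoothTransition.monotone (by gcongr)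
  have := neumannLHS_radial hh (Ψ := Ψ) (L * Real.cos α)
    (fun r _ => (hdiff r).hasDerivAt) hx
  change 0 ≤ neumannLHS h (fun y => Ψ (‖y - axisPt d (L * Real.cos α)‖ ^ 2)) x
  rw [this]
  exact mul_nonneg (mul_nonneg (by positivity) (hmono.deriv_nonneg)) (hh.starShaped _)

lemma exists_lapW_radialStep_le (hh : IsFunnel d R α L h) (ξ : Euc d) (a b P : ℝ) :
    ∃ B, 0 ≤ B ∧ ∀ x ∈ funnel d h, ‖x - ξ‖ ≤ P →
      |lapW (closure (funnel d h)) (radialStep ξ a b) x| ≤ B := by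
  obtain ⟨B, hB⟩ := (isCompact_closure_inter h ξ P).exists_bound_of_continuousOn
    ((continuousOn_lapW hh.uniqueDiffOn
      (contDiff_radialStep (n := 2) ξ a b).contDiffOn).mono inter_subset_left)
  refine ⟨max B 0, le_max_right _ _, fun x hx hxP =>
    le_max_of_le_left (hB x ⟨subset_closure hx, ?_⟩)⟩
  rwa [mem_closedBall_iff_norm]

/-- Along an interval of good times issued from a time with bounded Laplacian, `u` decreases at
most linearly. -/
lemma lower_bound_of_good_gap (hh : IsFunnel d R α L h) (hu : IsEntireSolution d h f c φ u)
    (hMf : ∀ a ∈ Icc (0 : ℝ) 1, |f a| ≤ Mf) {P P' P'' n B a s : ℝ} (hP' : 0 ≤ P') (hP'' : P' < P'')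
    (hP : P'' < P)
    (hB : ∀ x ∈ funnel d h, ‖x - axisPt d (L * Real.cos α)‖ ≤ P → |lapW (closure (funnel d h))
      (radialStep (axisPt d (L * Real.cos α)) P' P'') x| ≤ B)
    (hn : ∀ x ∈ funnel d h ∩ Metric.ball (axisPt d (L * Real.cos α)) P,
      |lapW (closure (funnel d h)) (u a) x| ≤ n)
    (hC : 0 ≤ n + B + Mf) (has : a ≤ s)
    (hgood : ∀ t ∈ Ioo a s, GoodTime h f u (axisPt d (L * Real.cos α)) P K t)
    {x : Euc d} (hx : x ∈ funnel d h) (hxP : ‖x - axisPt d (L * Real.cos α)‖ ≤ P') :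
    u a x - (n + B + Mf) * (s - a) ≤ u s x := by
  set ξ := axisPt d (L * Real.cos α) with hξ
  set C := n + B + Mf with hCdef
  set χ := radialStep ξ P' P'' with hχ
  have hχ2 : ContDiffOn ℝ 2 χ (closure (funnel d h)) :=
    (contDiff_radialStep (n := 2) ξ P' P'').contDiffOn
  have hsupp : ∀ t ∈ Icc a s, ∀ x ∈ closure (funnel d h), 0 < u a x - χ x - C * (t - a) →
      ‖x - ξ‖ ≤ P'' := by
    intro t ht x hx hpos
    by_contra! hlt
    rw [hχ, radialStep_one hP'' hP' hlt.le] at hpos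
    have := (hu.range01 a x hx).2
    have := mul_nonneg hC (sub_nonneg.2 ht.1)
    linarith
  have hle : ∀ t ∈ Icc a s, ∀ x ∈ closure (funnel d h), u a x - χ x - C * (t - a) ≤ 1 := by
    intro t ht x hx
    have := (hu.range01 a x hx).2
    have := mul_nonneg hC (sub_nonneg.2 ht.1)
    have := radialStep_nonneg ξ P' P'' x
    linarith
  have htest : IsTest h f u ξ P a s (fun t x => u a x - χ x - C * (t - a)) (fun _ _ => -C) := by
    refine ⟨⟨P'', by linarith, hP, hsupp⟩, ⟨C, fun t _ t' _ x _ => ?_⟩, hle, fun t _ => ?_,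
      fun t _ x _ => ?_, fun t ht x hx hlt => ?_, fun t _ x hx _ => ?_⟩
    · have : u a x - χ x - C * (t - a) - (u a x - χ x - C * (t' - a)) = -(C * (t - t')) := by ring
      rw [this, abs_neg, abs_mul, abs_of_nonneg hC]
    · exact ((hu.space_reg a).sub hχ2).sub contDiffOn_const
    · simpa using (((hasDerivAt_id t).sub_const a).const_mul C).const_sub (u a x - χ x)
    · have hx' := subset_closure hx
      have ht' := Ico_subset_Icc_self ht
      have hpos := (hu.range01 t x hx').1.trans_lt hlt
      have hr := hsupp t ht' x hx' hpos
      rw [lapW_sub_const hh.uniqueDiffOn ((hu.space_reg a).sub hχ2) _ hx',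
        lapW_sub hh.uniqueDiffOn (hu.space_reg a) hχ2 hx']
      have h1 := abs_le.1 (hn x ⟨hx, by rw [mem_ball_iff_norm]; linarith⟩)
      have h2 := abs_le.1 (hB x hx (by linarith))
      have h3 := abs_le.1 (hMf _ ⟨hpos.le, hle t ht' x hx'⟩)
      linarith [h1.1, h2.2, h3.1]
    · have hx' := frontier_subset_closure hx
      have hd := (hu.space_reg a).differentiableOn (by norm_num)
      have hdχ := hχ2.differentiableOn (by norm_num)
      rw [neumannLHS_sub_const hh.uniqueDiffOn (hd.fun_sub hdχ) _ hx',
        neumannLHS_sub hh.uniqueDiffOn hd hdχ hx', hu.neumann a x hx]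
      linarith [neumannLHS_radialStep_nonneg hh hP'' hP' hx]
  have := le_of_goodTime hh hu htest hgood (fun x hx => by
    have := radialStep_nonneg ξ P' P'' x
    simp only [sub_self, mul_zero]
    linarith) s ⟨has, le_rfl⟩ x (subset_closure hx)
  rw [hχ, radialStep_zero hP'' hP' hxP] at this
  linarith

/-- Real induction: if `G` does not decrease immediately after points of the closed set `S`, nor
across the gaps of `S`, then it stays above its value at a point of `S`. -/
lemma le_of_gaps {S : Set ℝ} (hS : IsClosed S) {G : ℝ → ℝ} (hG : Continuous G) {t s : ℝ}
    (hts : t ≤ s) (ht : t ∈ S)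
    (hinc : ∀ τ ∈ S ∩ Ico t s, ∀ᶠ σ in 𝓝[>] τ, G τ ≤ G σ)
    (hgap : ∀ τ ∈ S ∩ Ico t s, ∀ σ ∈ Ioc τ s, Ioo τ σ ⊆ Sᶜ → G τ ≤ G σ) : G t ≤ G s := by
  set E := Icc t s ∩ (S ∩ {τ | G t ≤ G τ}) with hE
  have hEc : IsCompact E :=
    isCompact_Icc.inter_right (hS.inter (isClosed_le continuous_const hG))
  obtain ⟨σ, hσE, hσmax⟩ := hEc.exists_isGreatest ⟨t, ⟨le_rfl, hts⟩, ht, le_refl (G t)⟩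
  obtain ⟨⟨htσ, hσs⟩, hσS, hGσ⟩ := hσE
  simp only [mem_ofPred_eq] at hGσ
  rcases hσs.eq_or_lt with rfl | hlt
  · exact hGσ
  have hσ' : σ ∈ S ∩ Ico t s := ⟨hσS, htσ, hlt⟩
  obtain ⟨m, hm, hmS⟩ : ∃ m ∈ Ioc σ s, Ioo σ m ⊆ Sᶜ := by
    obtain ⟨m, hm, hsub⟩ := mem_nhdsGT_iff_exists_Ioc_subset.1 (hinc σ hσ')
    refine ⟨min m s, ⟨lt_min hm hlt, min_le_right _ _⟩, fun τ hτ hτS => ?_⟩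
    have h1 : G σ ≤ G τ := hsub ⟨hτ.1, hτ.2.le.trans (min_le_left _ _)⟩
    have := hσmax (⟨⟨htσ.trans hτ.1.le, hτ.2.le.trans (min_le_right _ _)⟩, hτS,
      hGσ.trans h1⟩ : τ ∈ E)
    exact absurd hτ.1 this.not_gt
  by_cases hne : (Icc m s ∩ S).Nonempty
  · obtain ⟨e, he, hemin⟩ := (isCompact_Icc.inter_right hS).exists_isLeast hne
    have hσe : σ < e := hm.1.trans_le he.1.1
    have h1 : G σ ≤ G e := hgap σ hσ' e ⟨hσe, he.1.2⟩ fun τ hτ hτS => by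
      rcases lt_or_ge τ m with h2 | h2
      · exact hmS ⟨hτ.1, h2⟩ hτS
      · exact absurd hτ.2 (hemin ⟨⟨h2, hτ.2.le.trans he.1.2⟩, hτS⟩).not_gt
    have := hσmax (⟨⟨htσ.trans hσe.le, he.1.2⟩, he.2, hGσ.trans h1⟩ : e ∈ E)
    exact absurd hσe this.not_gt
  · refine hGσ.trans (hgap σ hσ' s ⟨hlt, le_rfl⟩ fun τ hτ hτS => ?_)
    rcases lt_or_ge τ m with h2 | h2
    · exact hmS ⟨hτ.1, h2⟩ hτS
    · exact hne ⟨τ, ⟨h2, hτ.2.le⟩, hτS⟩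

theorem goodTime_all (hh : IsFunnel d R α L h) (hu : IsEntireSolution d h f c φ u)
    (hK : ∀ a ∈ Icc (0 : ℝ) 1, ∀ b ∈ Icc (0 : ℝ) 1, |f a - f b| ≤ K * |a - b|)
    (hMf : ∀ a ∈ Icc (0 : ℝ) 1, |f a| ≤ Mf) (P t : ℝ) :
    GoodTime h f u (axisPt d (L * Real.cos α)) P K t := by
  set ξ := axisPt d (L * Real.cos α) with hξ
  have hMf0 : 0 ≤ Mf := (abs_nonneg _).trans (hMf 0 ⟨le_rfl, zero_le_one⟩)
  set U := interior {t | GoodTime h f u ξ P K t} with hU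
  have hUgood : ∀ t ∈ U, GoodTime h f u ξ P K t := fun t ht => interior_subset ht
  by_contra hbad
  have hSc : IsClosed Uᶜ := isOpen_interior.isClosed_compl
  have hne : (Uᶜ).Nonempty := ⟨t, fun ht => hbad (hUgood t ht)⟩
  obtain ⟨A, hAc, hAu, hA⟩ := exists_closed_cover hh hu.space_reg
    (fun x hx => (hu.time_diff x hx).continuous) ξ P
  have : CompleteSpace (Uᶜ : Set ℝ) := hSc.completeSpace_coe
  have : Nonempty (Uᶜ : Set ℝ) := hne.to_subtype
  obtain ⟨n, hn⟩ := nonempty_interior_of_iUnion_of_closed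
    (f := fun n => (Subtype.val ⁻¹' A n : Set (Uᶜ : Set ℝ)))
    (fun n => (hAc n).preimage continuous_subtype_val)
    (by rw [← preimage_iUnion, hAu, preimage_univ])
  obtain ⟨⟨t0, ht0⟩, hInteg⟩ := hn
  obtain ⟨r, hr, hball⟩ := Metric.mem_nhds_iff.1 (mem_interior_iff_mem_nhds.1 hInteg)
  have hSA : ∀ s ∈ Uᶜ, s ∈ Ioo (t0 - r) (t0 + r) → s ∈ A n := fun s hs hsI => by
    have : (⟨s, hs⟩ : (Uᶜ : Set ℝ)) ∈ Metric.ball (⟨t0, ht0⟩ : (Uᶜ : Set ℝ)) r := by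
      rw [Metric.mem_ball, Subtype.dist_eq, Real.dist_eq, abs_lt]
      constructor <;> linarith [hsI.1, hsI.2]
    exact hball this
  have hI : Ioo (t0 - r) (t0 + r) ⊆ {t | GoodTime h f u ξ P K t} := by
    intro t htI
    by_cases htU : t ∈ U
    · exact hUgood t htU
    refine goodTime_of_lower_bound hh hu hK fun P' hP' hP'P => ?_
    obtain ⟨P'', h1, h2⟩ := exists_between hP'P
    obtain ⟨B, hB0, hB⟩ := exists_lapW_radialStep_le hh ξ P' P'' P
    have hC : 0 ≤ n + B + Mf := by positivity
    refine ⟨t0 + r - t, by linarith [htI.2], n + B + Mf + 1, fun s hs x hx hxP => ?_⟩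
    have hx' := subset_closure hx
    have hxD : x ∈ funnel d h ∩ Metric.ball ξ P := ⟨hx, by rw [mem_ball_iff_norm]; linarith⟩
    have hinI : ∀ τ ∈ Ico t s, τ ∈ Ioo (t0 - r) (t0 + r) := fun τ hτ =>
      ⟨htI.1.trans_le hτ.1, by linarith [hτ.2, hs.2]⟩
    have := le_of_gaps hSc (G := fun τ => u τ x + (n + B + Mf + 1) * (τ - t))
      ((hu.time_diff x hx').continuous.add (by fun_prop)) hs.1.le htU
      (fun τ hτ => ?_) (fun τ hτ σ hσ hgap => ?_)
    · simp only [sub_self, mul_zero, add_zero] at this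
      linarith
    · have hd : HasDerivAt (fun τ => u τ x + (n + B + Mf + 1) * (τ - t))
          (lapW (closure (funnel d h)) (u τ) x + f (u τ x) + (n + B + Mf + 1)) τ := by
        rw [← hu.pde τ x hx']
        simpa using (hu.time_diff x hx' τ).hasDerivAt.fun_add
          (((hasDerivAt_id τ).sub_const t).const_mul (n + B + Mf + 1 : ℝ))
      have hpos : 0 < lapW (closure (funnel d h)) (u τ) x + f (u τ x) + (n + B + Mf + 1) := by
        have h3 := (abs_le.1 (hA n τ (hSA τ hτ.1 (hinI τ hτ.2)) x hxD)).1
        have h4 := (abs_le.1 (hMf _ (hu.range01 τ x hx'))).1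
        linarith
      have hslope := (hasDerivAt_iff_tendsto_slope.1 hd).mono_left
        (nhdsWithin_mono τ (fun σ (hσ : σ ∈ Ioi τ) => ne_of_gt hσ))
      filter_upwards [hslope.eventually_const_lt hpos, self_mem_nhdsWithin] with σ hσ hσ'
      rw [slope_def_field] at hσ
      have := (div_pos_iff_of_pos_right (sub_pos.2 hσ')).1 hσ
      linarith
    · have := lower_bound_of_good_gap (K := K) hh hu hMf hP' h1 h2 hB
        (hA n τ (hSA τ hτ.1 (hinI τ hτ.2))) hC hσ.1.le
        (fun ρ hρ => hUgood ρ (not_not.1 (hgap hρ))) hx hxP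
      have := hσ.1
      nlinarith
  exact ht0 (interior_maximal hI isOpen_Ioo ⟨by linarith, by linarith⟩)

lemma Bistable.exists_lipschitz {θ : ℝ} (hf : Bistable f θ) :
    ∃ K, ∀ a ∈ Icc (0 : ℝ) 1, ∀ b ∈ Icc (0 : ℝ) 1, |f a - f b| ≤ K * |a - b| := by
  obtain ⟨K, hK⟩ := isCompact_Icc.exists_bound_of_continuousOn (s := Icc (0 : ℝ) 1)
    (hf.smooth.continuous_deriv le_rfl).continuousOn
  refine ⟨K, fun a ha b hb => ?_⟩
  exact (convex_Icc (0 : ℝ) 1).norm_image_sub_le_of_norm_deriv_le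
    (fun x _ => hf.smooth.differentiable (by norm_num) x) hK hb ha

lemma Bistable.exists_bound {θ : ℝ} (hf : Bistable f θ) :
    ∃ M, ∀ a ∈ Icc (0 : ℝ) 1, |f a| ≤ M :=
  isCompact_Icc.exists_bound_of_continuousOn hf.smooth.continuous.continuousOn

/-- Comparison principle: a subsolution with bounded support which starts below `u` stays
below `u`. -/
theorem comparison {θ : ℝ} (hf : Bistable f θ) (hh : IsFunnel d R α L h)
    (hu : IsEntireSolution d h f c φ u) {P a b : ℝ} {z dz : ℝ → Euc d → ℝ}
    (hz : IsTest h f u (axisPt d (L * Real.cos α)) P a b z dz)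
    (hstart : ∀ x ∈ closure (funnel d h), z a x ≤ u a x) :
    ∀ t ∈ Icc a b, ∀ x ∈ closure (funnel d h), z t x ≤ u t x := by
  obtain ⟨K, hK⟩ := hf.exists_lipschitz
  obtain ⟨M, hM⟩ := hf.exists_bound
  exact le_of_goodTime hh hu hz (fun t _ => goodTime_all hh hu hK hM P t) hstart

end comparison

/-! ### Estimates on the planar front -/

section profile

variable {f φ : ℝ → ℝ} {θ c : ℝ}

namespace PlanarFront

lemma hasDerivAt (hφ : PlanarFront f θ c φ) (z : ℝ) : HasDerivAt φ (deriv φ z) z :=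
  (hφ.smooth.differentiable (by norm_num) z).hasDerivAt

lemma hasDerivAt_deriv (hφ : PlanarFront f θ c φ) (z : ℝ) :
    HasDerivAt (deriv φ) (deriv (deriv φ) z) z := by
  have : ContDiff ℝ 1 (deriv φ) := (contDiff_succ_iff_deriv (n := 1).1 hφ.smooth).2.2
  exact (this.differentiable (by norm_num) z).hasDerivAt

lemma continuous_deriv (hφ : PlanarFront f θ c φ) : Continuous (deriv φ) :=
  hφ.smooth.continuous_deriv (by norm_num)

lemma deriv_nonpos (hφ : PlanarFront f θ c φ) (z : ℝ) : deriv φ z ≤ 0 :=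
  hφ.anti.antitone.deriv_nonpos

lemma deriv_neg (hf : Bistable f θ) (hφ : PlanarFront f θ c φ) (z : ℝ) : deriv φ z < 0 := by
  refine lt_of_le_of_ne (hφ.deriv_nonpos z) fun h0 => ?_
  have hmax : IsLocalMax (deriv φ) z := Eventually.of_forall fun y => by
    rw [h0]; exact hφ.deriv_nonpos y
  have hode := hφ.ode z
  rw [hmax.deriv_eq_zero, h0, mul_zero, zero_add, zero_add] at hode
  have hz : φ z = θ := by
    rcases lt_trichotomy (φ z) θ with h1 | h1 | h1
    · exact absurd hode (hf.neg _ ⟨(hφ.mem z).1, h1⟩).ne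
    · exact h1
    · exact absurd hode (hf.pos _ ⟨h1, (hφ.mem z).2⟩).ne'
  have hz0 : z = 0 := hφ.anti.injective (hz.trans hφ.pin.symm)
  subst hz0
  have hd : ∀ y, HasDerivAt (fun y => Real.exp (c * y) * deriv φ y)
      (-(Real.exp (c * y) * f (φ y))) y := fun y => by
    have h1 : HasDerivAt (fun y => Real.exp (c * y)) (Real.exp (c * y) * c) y := by
      simpa using ((hasDerivAt_id y).const_mul c).exp
    refine (h1.fun_mul (hφ.hasDerivAt_deriv y)).congr_deriv ?_
    have := hφ.ode y
    have e : f (φ y) = -deriv (deriv φ) y - c * deriv φ y := by linarith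
    rw [e]
    ring
  have hanti : StrictAntiOn (fun y => Real.exp (c * y) * deriv φ y) (Iic 0) := by
    refine strictAntiOn_of_deriv_neg (convex_Iic 0)
      (fun y _ => (hd y).continuousAt.continuousWithinAt) fun y hy => ?_
    rw [interior_Iic] at hy
    have hy' : θ < φ y := hφ.pin ▸ hφ.anti hy
    rw [(hd y).deriv]
    have := mul_pos (Real.exp_pos (c * y)) (hf.pos _ ⟨hy', (hφ.mem y).2⟩)
    linarith
  have h1 := hanti (show (-1 : ℝ) ∈ Iic 0 by norm_num) (show (0 : ℝ) ∈ Iic 0 by norm_num)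
    (by norm_num)
  simp only [h0, mul_zero] at h1
  have := mul_nonpos_of_nonneg_of_nonpos (Real.exp_pos (c * -1)).le (hφ.deriv_nonpos (-1))
  linarith

lemma exists_deriv_bound (hf : Bistable f θ) (hφ : PlanarFront f θ c φ) :
    ∃ B > 0, ∀ z, -deriv φ z ≤ B := by
  obtain ⟨M, hM⟩ := hf.exists_bound
  have hM0 : 0 ≤ M := (abs_nonneg _).trans (hM 0 ⟨le_rfl, zero_le_one⟩)
  have hc := hφ.cpos
  refine ⟨1 + c + M, by linarith, fun z => ?_⟩
  obtain ⟨y, hy, hy'⟩ := exists_hasDerivAt_eq_slope φ (deriv φ) (lt_add_one z)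
    hφ.smooth.continuous.continuousOn fun y _ => hφ.hasDerivAt y
  rw [add_sub_cancel_left, div_one] at hy'
  have hd : ∀ y, HasDerivAt (fun y => deriv φ y + c * φ y) (-f (φ y)) y := fun y => by
    refine ((hφ.hasDerivAt_deriv y).fun_add ((hφ.hasDerivAt y).const_mul c)).congr_deriv ?_
    linarith [hφ.ode y]
  have hlip := convex_univ.norm_image_sub_le_of_norm_hasDerivWithin_le (C := M)
    (fun x _ => (hd x).hasDerivWithinAt)
    (fun x _ => by
      rw [norm_neg]; exact hM _ ⟨(hφ.mem x).1.le, (hφ.mem x).2.le⟩) (mem_univ z) (mem_univ y)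
  rw [Real.norm_eq_abs, Real.norm_eq_abs, abs_of_pos (sub_pos.2 hy.1)] at hlip
  have h1 := (abs_le.1 hlip).2
  have h2 : M * (y - z) ≤ M := by nlinarith [hy.2]
  have h3 := (hφ.mem z).1
  have h4 := (hφ.mem z).2
  have h5 := (hφ.mem (z + 1)).1
  have h6 := mul_pos hc (hφ.mem y).1
  have h7 := mul_lt_mul_of_pos_left h4 hc
  linarith

end PlanarFront

lemma Bistable.exists_decay (hf : Bistable f θ) : ∃ k > 0, ∃ η > 0, η ≤ 1 / 4 ∧
    (∀ a b, -η ≤ a → a ≤ b → b ≤ η → k * (b - a) ≤ f a - f b) ∧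
    (∀ a b, 1 - η ≤ a → a ≤ b → b ≤ 1 → k * (b - a) ≤ f a - f b) := by
  have hcont : Continuous (deriv f) := hf.smooth.continuous_deriv le_rfl
  have h0 := hf.df0
  have h1 := hf.df1
  obtain ⟨k, hk, hk0, hk1⟩ : ∃ k > 0, deriv f 0 < -k ∧ deriv f 1 < -k := by
    refine ⟨min (-deriv f 0) (-deriv f 1) / 2, ?_, ?_, ?_⟩
    · have := lt_min (neg_pos.2 h0) (neg_pos.2 h1)
      linarith
    · have := min_le_left (-deriv f 0) (-deriv f 1)
      linarith
    · have := min_le_right (-deriv f 0) (-deriv f 1)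
      linarith
  obtain ⟨η₀, hη₀, hb₀⟩ := Metric.nhds_basis_closedBall.mem_iff.1
    (hcont.continuousAt.eventually_lt_const hk0)
  obtain ⟨η₁, hη₁, hb₁⟩ := Metric.nhds_basis_closedBall.mem_iff.1
    (hcont.continuousAt.eventually_lt_const hk1)
  have key : ∀ a b, a ≤ b → (∀ x ∈ Icc a b, deriv f x < -k) → k * (b - a) ≤ f a - f b := by
    intro a b hab hd
    have := (convex_Icc a b).image_sub_le_mul_sub_of_deriv_le (C := -k)
      hf.smooth.continuous.continuousOn
      (fun x _ => (hf.smooth.differentiable (by norm_num) x).differentiableWithinAt)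
      (fun x hx => (hd x (interior_subset hx)).le) a ⟨le_rfl, hab⟩ b ⟨hab, le_rfl⟩ hab
    linarith
  refine ⟨k, hk, min (min η₀ η₁) (1 / 4), by positivity, min_le_right _ _,
    fun a b ha hab hb => key a b hab fun x hx => hb₀ ?_,
    fun a b ha hab hb => key a b hab fun x hx => hb₁ ?_⟩
  · have : min (min η₀ η₁) (1 / 4) ≤ η₀ := (min_le_left _ _).trans (min_le_left _ _)
    rw [Metric.mem_closedBall, Real.dist_eq, abs_le]
    constructor <;> linarith [hx.1, hx.2]
  · have : min (min η₀ η₁) (1 / 4) ≤ η₁ := (min_le_left _ _).trans (min_le_right _ _)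
    rw [Metric.mem_closedBall, Real.dist_eq, abs_le]
    constructor <;> linarith [hx.1, hx.2]

/-- Lowering the front by a small constant `δ` gains a uniform amount in the equation. -/
lemma exists_profile (hf : Bistable f θ) (hφ : PlanarFront f θ c φ) :
    ∃ δ > 0, δ ≤ 1 / 8 ∧ ∃ k > 0, ∃ γ > 0, ∃ M > 0,
      (∀ v, 0 ≤ v → v ≤ 2 * δ → k * v ≤ f (1 - v)) ∧
      (∀ z, γ ≤ c / 2 * -deriv φ z + f (φ z - δ) - f (φ z)) ∧
      ∀ z ≤ -M, γ ≤ f (φ z - δ) - f (φ z) ∧ 0 ≤ f (φ z) := by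
  obtain ⟨k, hk, η, hη, hη4, hd0, hd1⟩ := hf.exists_decay
  have hc := hφ.cpos
  obtain ⟨M₀, hM₀⟩ := eventually_atBot.1 (hφ.lim_bot.eventually_const_lt
    (show 1 - η / 2 < 1 by linarith))
  obtain ⟨M₁, hM₁⟩ := eventually_atTop.1 (hφ.lim_top.eventually_lt_const
    (show 0 < η / 2 by linarith))
  obtain ⟨z₀, -, hz₀⟩ := (isCompact_Icc (a := -(|M₀| + 1)) (b := |M₁|)).exists_isMaxOn
    ⟨0, by constructor <;> linarith [abs_nonneg M₀, abs_nonneg M₁]⟩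
    hφ.continuous_deriv.continuousOn
  have hκ := PlanarFront.deriv_neg hf hφ z₀
  obtain ⟨K, hK⟩ := isCompact_Icc.exists_bound_of_continuousOn (s := Icc (-1 : ℝ) 1)
    (hf.smooth.continuous_deriv le_rfl).continuousOn
  have hK0 : 0 ≤ K := (norm_nonneg _).trans (hK 0 (by norm_num))
  obtain ⟨δ, hδ, hδη, hδK⟩ : ∃ δ > 0, δ ≤ η / 2 ∧ (K + k) * δ ≤ c / 2 * -deriv φ z₀ := by
    refine ⟨min (η / 2) (c / 2 * -deriv φ z₀ / (K + k)), ?_, min_le_left _ _, ?_⟩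
    · have : 0 < -deriv φ z₀ := by linarith
      positivity
    · rw [mul_comm, ← le_div_iff₀ (by positivity)]
      exact min_le_right _ _
  have hnear : ∀ z ≤ -(|M₀| + 1), k * δ ≤ f (φ z - δ) - f (φ z) ∧ 0 ≤ f (φ z) := fun z hz => by
    have h1 := hM₀ z (by linarith [neg_abs_le M₀])
    have h2 := (hφ.mem z).2
    have h3 := hd1 (φ z - δ) (φ z) (by linarith) (by linarith) h2.le
    have h4 := hd1 (φ z) 1 (by linarith) h2.le le_rfl
    rw [hf.f1] at h4
    have := mul_pos hk (sub_pos.2 h2)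
    exact ⟨by linarith [show k * (φ z - (φ z - δ)) = k * δ by ring], by linarith⟩
  refine ⟨δ, hδ, by linarith, k, hk, k * δ, by positivity, |M₀| + 1, by positivity,
    fun v hv hvδ => ?_, fun z => ?_, hnear⟩
  · have := hd1 (1 - v) 1 (by linarith) (by linarith) le_rfl
    rw [hf.f1] at this
    linarith [show k * (1 - (1 - v)) = k * v by ring]
  · have hp : 0 ≤ c / 2 * -deriv φ z :=
      mul_nonneg (by linarith) (by linarith [hφ.deriv_nonpos z])
    rcases le_or_gt z (-(|M₀| + 1)) with h1 | h1
    · linarith [(hnear z h1).1]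
    rcases le_or_gt (|M₁|) z with h2 | h2
    · have h3 := hM₁ z ((le_abs_self _).trans h2)
      have h4 := (hφ.mem z).1
      have h5 := hd0 (φ z - δ) (φ z) (by linarith) (by linarith) (by linarith)
      linarith [show k * (φ z - (φ z - δ)) = k * δ by ring]
    · have h3 : deriv φ z ≤ deriv φ z₀ := hz₀ ⟨h1.le, h2.le⟩
      have h4 := (hφ.mem z).1
      have h5 := (hφ.mem z).2
      have h6 := (convex_Icc (-1 : ℝ) 1).norm_image_sub_le_of_norm_deriv_le (f := f)
        (fun x _ => hf.smooth.differentiable (by norm_num) x) hK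
        (show φ z ∈ Icc (-1 : ℝ) 1 by constructor <;> linarith)
        (show φ z - δ ∈ Icc (-1 : ℝ) 1 by constructor <;> linarith)
      have e : φ z - δ - φ z = -δ := by ring
      rw [e, norm_neg, Real.norm_eq_abs, Real.norm_eq_abs, abs_of_pos hδ] at h6
      have h7 := (abs_le.1 h6).1
      have h8 : c / 2 * -deriv φ z₀ ≤ c / 2 * -deriv φ z :=
        mul_le_mul_of_nonneg_left (by linarith) (by linarith)
      linarith [show (K + k) * δ = K * δ + k * δ by ring]

/-- The differential inequality behind the expanding and sliding subsolutions. -/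
lemma exists_radial_ineq (hf : Bistable f θ) (hφ : PlanarFront f θ c φ) (N : ℝ) (hN : 0 ≤ N) :
    ∃ δ > 0, δ ≤ 1 / 8 ∧ ∃ k > 0, ∃ A > 0, ∃ σ > 0, ∃ ρ₀ > 0,
      (∀ v, 0 ≤ v → v ≤ 2 * δ → k * v ≤ f (1 - v)) ∧
      ∀ q ρ v, A ≤ q → ρ₀ ≤ ρ → v ≤ σ →
        -deriv φ (q - ρ) * v ≤ deriv (deriv φ) (q - ρ) * (1 - A ^ 2 / q ^ 2) +
          N * deriv φ (q - ρ) / q + f (φ (q - ρ) - δ) := by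
  obtain ⟨δ, hδ, hδ8, k, hk, γ, hγ, M, hM, hdecay, hall, hnear⟩ := exists_profile hf hφ
  obtain ⟨B, hB, hBφ⟩ := PlanarFront.exists_deriv_bound hf hφ
  obtain ⟨F, hF⟩ := hf.exists_bound
  have hF0 : 0 ≤ F := (abs_nonneg _).trans (hF 0 ⟨le_rfl, zero_le_one⟩)
  have hc := hφ.cpos
  set η := min (c / 4) (γ / B) with hη
  have hη0 : 0 < η := by positivity
  have hηB : B * η ≤ γ := by
    rw [mul_comm, ← le_div_iff₀ hB]; exact min_le_right _ _
  set S := max 4 (F / γ) with hS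
  have hS4 : 4 ≤ S := le_max_left _ _
  have hSF : F ≤ γ * S := by
    rw [mul_comm, ← div_le_iff₀ hγ]; exact le_max_right _ _
  set A := 2 * (N + 1) / η with hA
  have hA0 : 0 < A := by positivity
  refine ⟨δ, hδ, hδ8, k, hk, A, hA0, η / 2, by positivity, M + A * S, by positivity, hdecay,
    fun q ρ v hq hρ hv => ?_⟩
  have hq0 : 0 < q := hA0.trans_le hq
  set z := q - ρ with hz
  set p := -deriv φ z with hp
  have hp0 : 0 ≤ p := by linarith [hφ.deriv_nonpos z]
  set e := A ^ 2 / q ^ 2 with he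
  have he0 : 0 ≤ e := by positivity
  have he1 : e ≤ 1 := by
    rw [he, div_le_one (by positivity)]; gcongr
  have hode : deriv (deriv φ) z = c * p - f (φ z) := by linarith [hφ.ode z]
  have hNq : N / q ≤ η / 2 := by
    rw [div_le_iff₀ hq0]
    have : η * A = 2 * (N + 1) := by rw [hA]; field_simp
    nlinarith
  have hdφ : deriv φ z = -p := by rw [hp]; ring
  rw [hode, hdφ, show N * -p / q = -(p * (N / q)) by ring]
  have h1 : p * v ≤ p * (η / 2) := mul_le_mul_of_nonneg_left hv hp0
  have h2 : p * (N / q) ≤ p * (η / 2) := mul_le_mul_of_nonneg_left hNq hp0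
  have hexp : (c * p - f (φ z)) * (1 - e) = c * p - f (φ z) - c * p * e + e * f (φ z) := by ring
  rw [hexp]
  rcases le_or_gt z (-M) with hzM | hzM
  · obtain ⟨h3, h4⟩ := hnear z hzM
    have h5 : p * η ≤ γ := (mul_le_mul_of_nonneg_right (hBφ z) hη0.le).trans hηB
    have h6 : 0 ≤ c * p * (1 - e) := by
      have : 0 ≤ 1 - e := by linarith
      positivity
    have h7 := mul_nonneg he0 h4
    linarith
  · have hqS : A * S ≤ q := by linarith
    have heS : e * S ≤ 1 := by
      rw [he, div_mul_eq_mul_div, div_le_one (by positivity)]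
      have : (A * S) ^ 2 ≤ q ^ 2 := by gcongr
      have : A ^ 2 * S ≤ (A * S) ^ 2 := by
        rw [mul_pow]
        exact mul_le_mul_of_nonneg_left (by nlinarith) (by positivity)
      linarith
    have he4 : e ≤ 1 / 4 := by nlinarith
    have heF : e * F ≤ γ := by nlinarith [mul_le_mul_of_nonneg_left hSF he0]
    have h3 := hall z
    have h4 := (abs_le.1 (hF _ ⟨(hφ.mem z).1.le, (hφ.mem z).2.le⟩)).1
    have h5 : -γ ≤ e * f (φ z) := by linarith [mul_le_mul_of_nonneg_left h4 he0]
    have h6 : p * η ≤ p * (c / 4) := mul_le_mul_of_nonneg_left (min_le_left _ _) hp0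
    have h7 : c * p * e ≤ c * p * (1 / 4) := mul_le_mul_of_nonneg_left he4 (by positivity)
    linarith

end profile

/-! ### Subsolutions built from the planar front -/

section cap

variable {d : ℕ} {R α L : ℝ} {h f φ : ℝ → ℝ} {θ c : ℝ} {u : ℝ → Euc d → ℝ} {A : ℝ}

/-- A smoothed distance to `ξ`. -/
def smoothDist (A : ℝ) (ξ x : Euc d) : ℝ := Real.sqrt (A ^ 2 + ‖x - ξ‖ ^ 2)

/-- The lowered front `φ - δ` wrapped around `ξ` at distance `ρ`. -/
def cap (φ : ℝ → ℝ) (A δ : ℝ) (ξ : Euc d) (ρ : ℝ) (x : Euc d) : ℝ :=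
  φ (smoothDist A ξ x - ρ) - δ

lemma le_smoothDist (A : ℝ) (ξ x : Euc d) : A ≤ smoothDist A ξ x :=
  Real.le_sqrt_of_sq_le (by nlinarith [norm_nonneg (x - ξ)])

lemma norm_le_smoothDist (A : ℝ) (ξ x : Euc d) : ‖x - ξ‖ ≤ smoothDist A ξ x :=
  Real.le_sqrt_of_sq_le (by nlinarith [sq_nonneg A])

lemma smoothDist_le (hA : 0 < A) (ξ x : Euc d) : smoothDist A ξ x ≤ A + ‖x - ξ‖ :=
  Real.sqrt_le_iff.2 ⟨by positivity, by nlinarith [norm_nonneg (x - ξ)]⟩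

lemma smoothDist_sq (A : ℝ) (ξ x : Euc d) : smoothDist A ξ x ^ 2 = A ^ 2 + ‖x - ξ‖ ^ 2 :=
  Real.sq_sqrt (by positivity)

lemma contDiff_cap (hφ : PlanarFront f θ c φ) (hA : 0 < A) (δ : ℝ) (ξ : Euc d) (ρ : ℝ) :
    ContDiff ℝ 2 (cap φ A δ ξ ρ) := by
  refine (hφ.smooth.comp (ContDiff.sub ?_ contDiff_const)).sub contDiff_const
  exact (contDiff_const.add ((contDiff_id.sub contDiff_const).norm_sq ℝ)).sqrt
    fun x => by positivity

lemma hasDerivAt_sqrt_add (hA : 0 < A) {r : ℝ} (hr : 0 ≤ r) :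
    HasDerivAt (fun r => Real.sqrt (A ^ 2 + r)) (1 / (2 * Real.sqrt (A ^ 2 + r))) r := by
  have h0 : A ^ 2 + r ≠ 0 := by positivity
  simpa using ((hasDerivAt_id r).const_add (A ^ 2)).sqrt h0

lemma hasDerivAt_capProfile (hφ : PlanarFront f θ c φ) (hA : 0 < A) (δ ρ : ℝ) {r : ℝ}
    (hr : 0 ≤ r) :
    HasDerivAt (fun r => φ (Real.sqrt (A ^ 2 + r) - ρ) - δ)
      (deriv φ (Real.sqrt (A ^ 2 + r) - ρ) / (2 * Real.sqrt (A ^ 2 + r))) r := by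
  have := ((hφ.hasDerivAt (Real.sqrt (A ^ 2 + r) - ρ)).comp r
    ((hasDerivAt_sqrt_add hA hr).sub_const ρ)).sub_const δ
  refine this.congr_deriv ?_
  ring

lemma hasDerivAt_capProfile_deriv (hφ : PlanarFront f θ c φ) (hA : 0 < A) (ρ : ℝ) {r : ℝ}
    (hr : 0 ≤ r) :
    HasDerivAt (fun r => deriv φ (Real.sqrt (A ^ 2 + r) - ρ) / (2 * Real.sqrt (A ^ 2 + r)))
      (deriv (deriv φ) (Real.sqrt (A ^ 2 + r) - ρ) / (4 * Real.sqrt (A ^ 2 + r) ^ 2) -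
        deriv φ (Real.sqrt (A ^ 2 + r) - ρ) / (4 * Real.sqrt (A ^ 2 + r) ^ 3)) r := by
  have hs := hasDerivAt_sqrt_add hA hr
  have hpos : 0 < Real.sqrt (A ^ 2 + r) := Real.sqrt_pos.2 (by positivity)
  have := ((hφ.hasDerivAt_deriv (Real.sqrt (A ^ 2 + r) - ρ)).comp r (hs.sub_const ρ)).fun_div
    (hs.const_mul 2) (by positivity)
  refine this.congr_deriv ?_
  simp only [Function.comp_apply]
  field_simp
  ring

lemma le_lapW_cap (hh : IsFunnel d R α L h) (hφ : PlanarFront f θ c φ) (hA : 0 < A) (δ : ℝ)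
    (ξ : Euc d) (ρ : ℝ) {x : Euc d} (hx : x ∈ closure (funnel d h)) :
    deriv (deriv φ) (smoothDist A ξ x - ρ) * (1 - A ^ 2 / smoothDist A ξ x ^ 2) +
      (d + 1) * deriv φ (smoothDist A ξ x - ρ) / smoothDist A ξ x ≤
    lapW (closure (funnel d h)) (cap φ A δ ξ ρ) x := by
  have key := lapW_radial hh.uniqueDiffOn ξ
    (fun r hr => hasDerivAt_capProfile hφ hA δ ρ hr)
    (fun r hr => hasDerivAt_capProfile_deriv hφ hA ρ hr) hx
  change lapW (closure (funnel d h)) (cap φ A δ ξ ρ) x = _ at key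
  have hq : Real.sqrt (A ^ 2 + ‖x - ξ‖ ^ 2) = smoothDist A ξ x := rfl
  rw [key, hq]
  have hq0 : 0 < smoothDist A ξ x := hA.trans_le (le_smoothDist A ξ x)
  have hr : ‖x - ξ‖ ^ 2 = smoothDist A ξ x ^ 2 - A ^ 2 := by rw [smoothDist_sq]; ring
  have hp := hφ.deriv_nonpos (smoothDist A ξ x - ρ)
  have hextra : 0 ≤ ‖x - ξ‖ ^ 2 * (-deriv φ (smoothDist A ξ x - ρ)) / smoothDist A ξ x ^ 3 := by
    have : 0 ≤ -deriv φ (smoothDist A ξ x - ρ) := by linarith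
    positivity
  rw [hr] at hextra ⊢
  generalize smoothDist A ξ x = q at *
  rw [← sub_nonneg]
  refine hextra.trans_eq ?_
  field_simp
  ring

lemma neumannLHS_cap_nonpos (hh : IsFunnel d R α L h) (hφ : PlanarFront f θ c φ) (hA : 0 < A)
    (δ ρ : ℝ) {x : Euc d} (hx : x ∈ frontier (funnel d h)) :
    neumannLHS h (cap φ A δ (axisPt d (L * Real.cos α)) ρ) x ≤ 0 := by
  have key := neumannLHS_radial hh (L * Real.cos α)
    (fun r hr => hasDerivAt_capProfile hφ hA δ ρ hr) hx
  change neumannLHS h (cap φ A δ (axisPt d (L * Real.cos α)) ρ) x = _ at key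
  rw [key]
  refine mul_nonpos_of_nonpos_of_nonneg (mul_nonpos_of_nonneg_of_nonpos (by positivity) ?_)
    (hh.starShaped _)
  exact div_nonpos_of_nonpos_of_nonneg (hφ.deriv_nonpos _) (by positivity)

lemma smoothDist_axisPt (A a : ℝ) (x : Euc d) :
    smoothDist A (axisPt d a) x = Real.sqrt (A ^ 2 + ((x 0 - a) ^ 2 + primeSq x)) := by
  rw [smoothDist, norm_sq_eq_add_primeSq, ← primeNorm_sq, primeNorm_sub_axisPt, primeNorm_sq]
  simp [axisPt_apply]

lemma hasDerivAt_smoothDist_axisPt (hA : 0 < A) (x : Euc d) {a : ℝ → ℝ} {a' t : ℝ}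
    (ha : HasDerivAt a a' t) :
    HasDerivAt (fun t => smoothDist A (axisPt d (a t)) x)
      (-((x 0 - a t) * a' / smoothDist A (axisPt d (a t)) x)) t := by
  have h0 : A ^ 2 + ((x 0 - a t) ^ 2 + primeSq x) ≠ 0 := by
    have := primeSq_nonneg x
    positivity
  have h1 : HasDerivAt (fun t => A ^ 2 + ((x 0 - a t) ^ 2 + primeSq x))
      (-(2 * (x 0 - a t) * a')) t := by
    refine ((((ha.const_sub (x 0)).fun_pow 2).add_const (primeSq x)).const_add
      (A ^ 2)).congr_deriv ?_
    push_cast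
    ring
  simp only [smoothDist_axisPt]
  refine (h1.sqrt h0).congr_deriv ?_
  field_simp

lemma abs_sub_le_smoothDist (A a : ℝ) (x : Euc d) :
    |x 0 - a| ≤ smoothDist A (axisPt d a) x := by
  refine le_trans ?_ (norm_le_smoothDist A (axisPt d a) x)
  simpa [axisPt_apply] using abs_apply_zero_le_norm (x - axisPt d a)

lemma primeNorm_le_smoothDist (A a : ℝ) (x : Euc d) :
    primeNorm x ≤ smoothDist A (axisPt d a) x := by
  rw [← primeNorm_sub_axisPt x a]
  exact (primeNorm_le_norm _).trans (norm_le_smoothDist A _ x)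

lemma norm_axisPt_sub (a b : ℝ) : ‖axisPt d a - axisPt d b‖ = |a - b| := by
  have : axisPt d a - axisPt d b = axisPt d (a - b) := by
    ext i
    simp only [PiLp.sub_apply, axisPt_apply]
    split_ifs <;> simp
  rw [this, axisPt, PiLp.norm_single, Real.norm_eq_abs]

/-- The wrapped front with centre `(a + s (t - T), 0)` and radius `ρ + v (t - T)` is a subsolution
as soon as it is small on the boundary or has the right conormal derivative there. -/
lemma isTest_cap (hh : IsFunnel d R α L h) (hf : Bistable f θ) (hφ : PlanarFront f θ c φ)
    {δ σ ρ₀ κ : ℝ} (hA : 0 < A) (hδ : 0 ≤ δ)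
    (hineq : ∀ q ρ v, A ≤ q → ρ₀ ≤ ρ → v ≤ σ →
        -deriv φ (q - ρ) * v ≤ deriv (deriv φ) (q - ρ) * (1 - A ^ 2 / q ^ 2) +
          (d + 1) * deriv φ (q - ρ) / q + f (φ (q - ρ) - δ))
    (hκ : φ κ ≤ δ) {a s ρ v T b : ℝ} (hs : 0 ≤ s) (hv : 0 ≤ v) (hsv : s + v ≤ σ) (hρ : ρ₀ ≤ ρ)
    (hneu : ∀ t ∈ Ico T b, ∀ x ∈ frontier (funnel d h),
      0 < cap φ A δ (axisPt d (a + s * (t - T))) (ρ + v * (t - T)) x →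
      neumannLHS h (cap φ A δ (axisPt d (a + s * (t - T))) (ρ + v * (t - T))) x ≤ 0) :
    ∃ P dz, IsTest h f u (axisPt d (L * Real.cos α)) P T b
      (fun t => cap φ A δ (axisPt d (a + s * (t - T))) (ρ + v * (t - T))) dz := by
  set q : ℝ → Euc d → ℝ := fun t x => smoothDist A (axisPt d (a + s * (t - T))) x with hq
  set w : ℝ → Euc d → ℝ := fun t x => v + (x 0 - (a + s * (t - T))) * s / q t x with hw
  have hqpos : ∀ t x, 0 < q t x := fun t x => hA.trans_le (le_smoothDist A _ x)
  have hder : ∀ t x, HasDerivAt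
      (fun t => cap φ A δ (axisPt d (a + s * (t - T))) (ρ + v * (t - T)) x)
      (-deriv φ (q t x - (ρ + v * (t - T))) * w t x) t := by
    intro t x
    have hlin : ∀ a s : ℝ, HasDerivAt (fun t => a + s * (t - T)) s t := fun a s => by
      simpa using (((hasDerivAt_id t).sub_const T).const_mul s).const_add a
    have h1 := (hasDerivAt_smoothDist_axisPt hA x (hlin a s)).fun_sub (hlin ρ v)
    have h2 := ((hφ.hasDerivAt (q t x - (ρ + v * (t - T)))).comp t h1).sub_const δ
    refine h2.congr_deriv ?_
    simp only [hw, hq]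
    ring
  have hwabs : ∀ t x, |w t x| ≤ σ := by
    intro t x
    have h1 : |(x 0 - (a + s * (t - T))) * s / q t x| ≤ s := by
      rw [abs_div, abs_mul, abs_of_nonneg hs, abs_of_pos (hqpos t x), div_le_iff₀ (hqpos t x),
        mul_comm s (q t x)]
      exact mul_le_mul_of_nonneg_right (abs_sub_le_smoothDist A _ x) hs
    have h2 := abs_add_le v ((x 0 - (a + s * (t - T))) * s / q t x)
    rw [abs_of_nonneg hv] at h2
    simp only [hw]
    linarith
  obtain ⟨B, hB, hBφ⟩ := PlanarFront.exists_deriv_bound hf hφ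
  have hpos : ∀ t x, 0 < cap φ A δ (axisPt d (a + s * (t - T))) (ρ + v * (t - T)) x →
      q t x < ρ + v * (t - T) + κ := by
    intro t x h0
    have h1 : φ κ < φ (q t x - (ρ + v * (t - T))) := by
      simp only [cap] at h0
      linarith
    have := hφ.anti.lt_iff_gt.1 h1
    linarith
  refine ⟨|ρ + v * (b - T) + κ| + (|a - L * Real.cos α| + s * |b - T|) + 1, _,
    ⟨_, by positivity, lt_add_one _, fun t ht x _ h0 => ?_⟩, ⟨B * σ, fun t _ t' _ x _ => ?_⟩,
    fun t _ x _ => ?_, fun t _ => (contDiff_cap hφ hA δ _ _).contDiffOn,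
    fun t _ x _ => hder t x, fun t ht x hx _ => ?_, hneu⟩
  · have h1 : ‖x - axisPt d (a + s * (t - T))‖ ≤ |ρ + v * (b - T) + κ| := by
      refine (norm_le_smoothDist A _ x).trans ((hpos t x h0).le.trans (le_trans ?_ (le_abs_self _)))
      have := mul_le_mul_of_nonneg_left ht.2 hv
      linarith
    have h2 : ‖axisPt d (a + s * (t - T)) - axisPt d (L * Real.cos α)‖ ≤
        |a - L * Real.cos α| + s * |b - T| := by
      rw [norm_axisPt_sub]
      have h3 := abs_add_le (a - L * Real.cos α) (s * (t - T))
      have h4 : |s * (t - T)| ≤ s * |b - T| := by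
        rw [abs_mul, abs_of_nonneg hs]
        refine mul_le_mul_of_nonneg_left ?_ hs
        rw [abs_of_nonneg (by linarith [ht.1] : 0 ≤ t - T)]
        exact (by linarith [ht.2] : t - T ≤ b - T).trans (le_abs_self _)
      have e : a + s * (t - T) - L * Real.cos α = a - L * Real.cos α + s * (t - T) := by ring
      rw [e]
      linarith
    exact (norm_sub_le_norm_sub_add_norm_sub x (axisPt d (a + s * (t - T))) _).trans
      (add_le_add h1 h2)
  · refine convex_univ.norm_image_sub_le_of_norm_hasDerivWithin_le (C := B * σ)
      (fun τ _ => (hder τ x).hasDerivWithinAt) (fun τ _ => ?_) (mem_univ t') (mem_univ t)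
    rw [norm_mul, Real.norm_eq_abs, Real.norm_eq_abs,
      abs_of_nonneg (by linarith [hφ.deriv_nonpos (q τ x - (ρ + v * (τ - T)))])]
    exact mul_le_mul (hBφ _) (hwabs τ x) (abs_nonneg _) hB.le
  · have := (hφ.mem (smoothDist A (axisPt d (a + s * (t - T))) x - (ρ + v * (t - T)))).2
    simp only [cap]
    linarith
  · refine (hineq (q t x) (ρ + v * (t - T)) (w t x) (le_smoothDist A _ x) ?_
      ((le_abs_self _).trans (hwabs t x))).trans (add_le_add_left
        (le_lapW_cap hh hφ hA δ _ _ (subset_closure hx)) _)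
    have := mul_nonneg hv (sub_nonneg.2 ht.1)
    linarith

end cap

/-! ### Propagation -/

section propagation

variable {d : ℕ} {R α L : ℝ} {h f φ : ℝ → ℝ} {θ c : ℝ} {u : ℝ → Euc d → ℝ} {A δ σ ρ₀ κ k : ℝ}

lemma smoothDist_lt_of_cap_pos (hφ : PlanarFront f θ c φ) (hκ : φ κ ≤ δ) {ξ x : Euc d} {ρ : ℝ}
    (hpos : 0 < cap φ A δ ξ ρ x) : smoothDist A ξ x < ρ + κ := by
  have h1 : φ κ < φ (smoothDist A ξ x - ρ) := by
    rw [cap] at hpos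
    linarith
  linarith [hφ.anti.lt_iff_gt.1 h1]

/-- Far in the past, a wrapped front lies below `u` near the end of the cylinder. -/
lemma exists_cap_le (hφ : PlanarFront f θ c φ) (hu : IsEntireSolution d h f c φ u) (hδ : 0 < δ)
    (hκ : φ κ ≤ δ) (ρ a₁ : ℝ) :
    ∃ T, ∃ a ≤ a₁, ∀ x ∈ closure (funnel d h), cap φ A δ (axisPt d a) ρ x ≤ u T x := by
  obtain ⟨T, hT⟩ := hu.past (δ / 2) (by positivity)
  obtain ⟨M, hM⟩ := eventually_atBot.1 (hφ.lim_bot.eventually_const_lt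
    (show 1 - δ / 2 < 1 by linarith))
  refine ⟨T, min a₁ (M + c * T - ρ - κ), min_le_left _ _, fun x hx => ?_⟩
  set a := min a₁ (M + c * T - ρ - κ) with ha
  rcases le_or_gt (cap φ A δ (axisPt d a) ρ x) 0 with h0 | h0
  · exact h0.trans (hu.range01 T x hx).1
  · have h1 := smoothDist_lt_of_cap_pos hφ hκ h0
    have h2 := (le_abs_self _).trans (abs_sub_le_smoothDist A a x)
    have h3 : a ≤ M + c * T - ρ - κ := min_le_right _ _
    have h4 := hM (x 0 - c * T) (by linarith)
    have h5 := (abs_le.1 (hT T le_rfl x hx)).1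
    have h6 := (hφ.mem (smoothDist A (axisPt d a) x - ρ)).2
    rw [cap]
    linarith

/-- Sliding a wrapped front along the axis, inside the cylinder of radius `R`. -/
lemma exists_centered_cap_le (hh : IsFunnel d R α L h) (hf : Bistable f θ)
    (hφ : PlanarFront f θ c φ) (hu : IsEntireSolution d h f c φ u) (hA : 0 < A) (hδ : 0 < δ)
    (hσ : 0 < σ)
    (hineq : ∀ q ρ v, A ≤ q → ρ₀ ≤ ρ → v ≤ σ →
        -deriv φ (q - ρ) * v ≤ deriv (deriv φ) (q - ρ) * (1 - A ^ 2 / q ^ 2) +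
          (d + 1) * deriv φ (q - ρ) / q + f (φ (q - ρ) - δ))
    (hκ : φ κ ≤ δ) (hR : ρ₀ + κ ≤ R) :
    ∃ T, ∀ x ∈ closure (funnel d h), cap φ A δ (axisPt d (L * Real.cos α)) ρ₀ x ≤ u T x := by
  obtain ⟨T, a, ha, hstart⟩ := exists_cap_le (A := A) hφ hu hδ hκ ρ₀ (L * Real.cos α)
  set b := T + (L * Real.cos α - a) / σ with hb
  have hTb : T ≤ b := by
    have : 0 ≤ (L * Real.cos α - a) / σ := div_nonneg (by linarith) hσ.le
    linarith
  obtain ⟨P, dz, hz⟩ := isTest_cap (a := a) (s := σ) (ρ := ρ₀) (v := 0) (T := T) (b := b) hh hf hφ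
    hA hδ.le hineq hκ hσ.le le_rfl (by linarith) le_rfl (fun t _ x hx hpos => by
      have h1 := smoothDist_lt_of_cap_pos hφ hκ hpos
      have h2 := primeNorm_le_smoothDist A (a + σ * (t - T)) x
      have h3 := hh.le_h (x 0)
      have h4 : x ∉ funnel d h := by
        rw [hh.isOpen_funnel.frontier_eq] at hx
        exact hx.2
      exact absurd (show primeNorm x < h (x 0) by linarith) h4)
  refine ⟨b, fun x hx => ?_⟩
  have := comparison hf hh hu hz (fun x hx => by simpa using hstart x hx) b ⟨hTb, le_rfl⟩ x hx
  have e : a + σ * (b - T) = L * Real.cos α := by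
    rw [hb]; field_simp; ring
  rwa [e, zero_mul, add_zero] at this

/-- Expanding the wrapped front from the centre of the funnel. -/
lemma eventually_ge (hh : IsFunnel d R α L h) (hf : Bistable f θ)
    (hφ : PlanarFront f θ c φ) (hu : IsEntireSolution d h f c φ u) (hA : 0 < A) (hδ : 0 < δ)
    (hσ : 0 < σ)
    (hineq : ∀ q ρ v, A ≤ q → ρ₀ ≤ ρ → v ≤ σ →
        -deriv φ (q - ρ) * v ≤ deriv (deriv φ) (q - ρ) * (1 - A ^ 2 / q ^ 2) +
          (d + 1) * deriv φ (q - ρ) / q + f (φ (q - ρ) - δ))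
    (hκ : φ κ ≤ δ) (hR : ρ₀ + κ ≤ R) (ρ : ℝ) :
    ∃ T, ∀ t ≥ T, ∀ x ∈ closure (funnel d h), ‖x - axisPt d (L * Real.cos α)‖ ≤ ρ →
      1 - 2 * δ ≤ u t x := by
  obtain ⟨T, hstart⟩ := exists_centered_cap_le hh hf hφ hu hA hδ hσ hineq hκ hR
  obtain ⟨M, hM⟩ := eventually_atBot.1 (hφ.lim_bot.eventually_const_lt
    (show 1 - δ < 1 by linarith))
  refine ⟨max T (T + (A + ρ - ρ₀ - M) / σ), fun t ht x hx hxρ => ?_⟩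
  obtain ⟨P, dz, hz⟩ := isTest_cap (a := L * Real.cos α) (s := 0) (ρ := ρ₀) (v := σ) (T := T)
    (b := t) hh hf hφ hA hδ.le hineq hκ le_rfl hσ.le (by linarith) le_rfl (fun τ _ x hx _ => by
      rw [zero_mul, add_zero]
      exact neumannLHS_cap_nonpos hh hφ hA _ _ hx)
  have h1 := comparison hf hh hu hz (fun x hx => by simpa using hstart x hx) t
    ⟨(le_max_left _ _).trans ht, le_rfl⟩ x hx
  rw [zero_mul, add_zero, cap] at h1
  have h2 := smoothDist_le hA (axisPt d (L * Real.cos α)) x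
  have h3 := (le_max_right _ _).trans ht
  have h4 : A + ρ - ρ₀ - M ≤ (t - T) * σ := by
    rw [← div_le_iff₀ hσ]; linarith
  have h5 := hM (smoothDist A (axisPt d (L * Real.cos α)) x - (ρ₀ + σ * (t - T))) (by linarith)
  linarith

/-- Once `u` is close to `1` on a large ball, it converges to `1` exponentially fast up to
an error which is small at the centre of the ball. -/
lemma one_sub_le (hh : IsFunnel d R α L h) (hf : Bistable f θ)
    (hu : IsEntireSolution d h f c φ u) (hk : 0 < k) (hδ : 0 < δ)
    (hdecay : ∀ v, 0 ≤ v → v ≤ 2 * δ → k * v ≤ f (1 - v)) {ρ T : ℝ} (hρ : 0 < ρ)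
    (hT : ∀ t ≥ T, ∀ x ∈ closure (funnel d h), ‖x - axisPt d (L * Real.cos α)‖ ≤ ρ →
      1 - 2 * δ ≤ u t x) {t : ℝ} (ht : T ≤ t) {x : Euc d} (hx : x ∈ closure (funnel d h)) :
    1 - 2 * δ * Real.exp (-(k * (t - T))) -
      (‖x - axisPt d (L * Real.cos α)‖ ^ 2 + 2 * (d + 1) / k) / ρ ^ 2 ≤ u t x := by
  set ξ := axisPt d (L * Real.cos α) with hξ
  set B := 2 * (d + 1) / k with hB
  have hB0 : 0 < B := by positivity
  set E : ℝ → ℝ := fun t => 2 * δ * Real.exp (-(k * (t - T))) with hE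
  have hE0 : ∀ t, 0 < E t := fun t => by positivity
  have hEd : ∀ t, HasDerivAt E (-(k * E t)) t := fun t => by
    have h1 : HasDerivAt (fun t => -(k * (t - T))) (-k) t := by
      simpa using (((hasDerivAt_id t).sub_const T).const_mul k).fun_neg
    refine (h1.exp.const_mul (2 * δ)).congr_deriv ?_
    simp only [hE]
    ring
  set z : ℝ → Euc d → ℝ := fun t x => 1 - E t - (‖x - ξ‖ ^ 2 + B) / ρ ^ 2 with hz
  have hzd : ∀ t x, HasDerivAt (fun t => z t x) (k * E t) t := fun t x => by
    exact (((hEd t).const_sub 1).sub_const ((‖x - ξ‖ ^ 2 + B) / ρ ^ 2)).congr_deriv (neg_neg _)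
  have hz1 : ∀ t x, z t x ≤ 1 := fun t x => by
    have := hE0 t
    have : 0 ≤ (‖x - ξ‖ ^ 2 + B) / ρ ^ 2 := by positivity
    simp only [hz]
    linarith
  have hsupp : ∀ t x, 0 < z t x → ‖x - ξ‖ ≤ ρ := fun t x hpos => by
    have h1 : (‖x - ξ‖ ^ 2 + B) / ρ ^ 2 < 1 := by
      have := hE0 t
      simp only [hz] at hpos
      linarith
    rw [div_lt_one (by positivity)] at h1
    exact abs_le_of_sq_le_sq' (by linarith) hρ.le |>.2
  have hΨ : ∀ t, ∀ r ≥ (0 : ℝ), HasDerivAt (fun r => 1 - E t - (r + B) / ρ ^ 2) (-(1 / ρ ^ 2)) r :=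
    fun t r _ => by
      simpa using ((((hasDerivAt_id r).add_const B).div_const (ρ ^ 2)).const_sub (1 - E t))
  have htest : IsTest h f u ξ (ρ + 1) T t z (fun t _ => k * E t) := by
    refine ⟨⟨ρ, hρ.le, lt_add_one _, fun t _ x _ hpos => hsupp t x hpos⟩,
      ⟨k * (2 * δ), fun s hs s' hs' x _ => ?_⟩, fun t _ x _ => hz1 t x, fun t _ => ?_,
      fun t _ x _ => hzd t x, fun s hs x hx hlt => ?_, fun s _ x hx _ => ?_⟩
    · refine (convex_Icc T t).norm_image_sub_le_of_norm_hasDerivWithin_le (C := k * (2 * δ))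
        (fun τ _ => (hzd τ x).hasDerivWithinAt) (fun τ hτ => ?_) hs' hs
      have h1 : E τ ≤ 2 * δ := by
        have : Real.exp (-(k * (τ - T))) ≤ 1 := by
          rw [Real.exp_le_one_iff]
          have := mul_nonneg hk.le (sub_nonneg.2 hτ.1)
          linarith
        simp only [hE]
        nlinarith
      rw [Real.norm_eq_abs, abs_of_nonneg (mul_nonneg hk.le (hE0 τ).le)]
      exact mul_le_mul_of_nonneg_left h1 hk.le
    · have : ContDiff ℝ 2 fun r : ℝ => 1 - E t - (r + B) / ρ ^ 2 := by fun_prop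
      exact (contDiff_radial this ξ).contDiffOn
    · have hx' := subset_closure hx
      have hpos := (hu.range01 s x hx').1.trans_lt hlt
      have h1 := hT s hs.1 x hx' (hsupp s x hpos)
      have h2 := hdecay (1 - z s x) (by linarith [hz1 s x]) (by linarith)
      rw [sub_sub_cancel] at h2
      have h3 := lapW_radial hh.uniqueDiffOn ξ (Ψ₂ := fun _ => 0) (hΨ s)
        (fun r _ => hasDerivAt_const r _) hx'
      change lapW (closure (funnel d h)) (z s) x = _ at h3
      rw [h3]
      have h4 : k * (1 - z s x) = k * E s + k * ‖x - ξ‖ ^ 2 / ρ ^ 2 + 2 * (d + 1) / ρ ^ 2 := by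
        simp only [hz, hB]
        field_simp
        ring
      have h5 : 0 ≤ k * ‖x - ξ‖ ^ 2 / ρ ^ 2 := by positivity
      have h6 : 2 * ((d : ℝ) + 1) * -(1 / ρ ^ 2) = -(2 * (d + 1) / ρ ^ 2) := by ring
      rw [h6, mul_zero, zero_add]
      linarith
    · have h3 := neumannLHS_radial hh (L * Real.cos α) (hΨ s) hx
      change neumannLHS h (z s) x = _ at h3
      rw [h3]
      refine mul_nonpos_of_nonpos_of_nonneg (mul_nonpos_of_nonneg_of_nonpos (by positivity) ?_)
        (hh.starShaped _)
      rw [neg_nonpos]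
      positivity
  refine comparison hf hh hu htest (fun x hx => ?_) t ⟨ht, le_rfl⟩ x hx
  rcases le_or_gt (z T x) 0 with h0 | h0
  · exact h0.trans (hu.range01 T x hx).1
  · refine le_trans ?_ (hT T le_rfl x hx (hsupp T x h0))
    have h1 : E T = 2 * δ := by simp [hE]
    have : 0 ≤ (‖x - ξ‖ ^ 2 + B) / ρ ^ 2 := by positivity
    simp only [hz, h1]
    linarith

end propagation

/-- Theorem 1.9: there is `R₀ > 0`, depending only on `f` and the dimension,
such that complete propagation holds in every funnel-shaped domain with `R ≥ R₀` and
`α ∈ (0, π/2)`. -/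
theorem statement5 (d : ℕ) (hd : 1 ≤ d) (f φ : ℝ → ℝ) (θ c : ℝ)
    (hf : Bistable f θ) (hφ : PlanarFront f θ c φ) :
    ∃ R₀ > (0 : ℝ), ∀ R α L : ℝ, ∀ h : ℝ → ℝ,
      IsFunnel d R α L h → R₀ ≤ R → 0 < α →
      ∀ u : ℝ → Euc d → ℝ, IsEntireSolution d h f c φ u →
        CompletePropagation d h u := by
  obtain ⟨δ, hδ, -, k, hk, A, hA, σ, hσ, ρ₀, hρ₀, hdecay, hineq⟩ :=
    exists_radial_ineq hf hφ (d + 1) (by positivity)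
  obtain ⟨κ, hκ, hκ0⟩ := ((hφ.lim_top.eventually_le_const hδ).and (eventually_ge_atTop 0)).exists
  refine ⟨ρ₀ + κ, by linarith, fun R α L h hh hR _ u hu => ?_⟩
  rw [CompletePropagation, Metric.tendstoLocallyUniformlyOn_iff]
  intro ε hε x hx
  refine ⟨Metric.ball x 1 ∩ closure (funnel d h), ?_, ?_⟩
  · exact inter_mem (mem_nhdsWithin_of_mem_nhds (Metric.ball_mem_nhds x one_pos))
      self_mem_nhdsWithin
  set r := ‖x - axisPt d (L * Real.cos α)‖ + 1 with hr
  have hr0 : 0 < r := by positivity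
  set B := 2 * ((d : ℝ) + 1) / k with hB
  have hB0 : 0 < B := by positivity
  set ρ := Real.sqrt ((r ^ 2 + B) * 2 / ε) with hρ
  have hρ0 : 0 < ρ := Real.sqrt_pos.2 (by positivity)
  have hρ2 : (r ^ 2 + B) / ρ ^ 2 = ε / 2 := by
    rw [hρ, Real.sq_sqrt (by positivity)]
    field_simp
  obtain ⟨T, hT⟩ := eventually_ge hh hf hφ hu hA hδ hσ hineq hκ hR ρ
  have hexp : Tendsto (fun t => 2 * δ * Real.exp (-(k * (t - T)))) atTop (𝓝 (2 * δ * 0)) := by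
    refine Tendsto.const_mul _ (Real.tendsto_exp_atBot.comp ?_)
    refine tendsto_neg_atTop_atBot.comp (Tendsto.const_mul_atTop hk ?_)
    exact tendsto_atTop_add_const_right _ (-T) tendsto_id
  rw [mul_zero] at hexp
  filter_upwards [hexp.eventually_lt_const (half_pos hε), eventually_ge_atTop T] with t ht htT y hy
  have h1 := one_sub_le hh hf hu hk hδ hdecay hρ0 hT htT hy.2
  have h2 : ‖y - axisPt d (L * Real.cos α)‖ ≤ r := by
    have := norm_sub_le_norm_sub_add_norm_sub y x (axisPt d (L * Real.cos α))
    have := mem_ball_iff_norm.1 hy.1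
    linarith
  have h3 : (‖y - axisPt d (L * Real.cos α)‖ ^ 2 + B) / ρ ^ 2 ≤ ε / 2 := by
    rw [← hρ2]; gcongr
  have h4 := (hu.range01 t y hy.2).2
  rw [Real.dist_eq, abs_of_nonneg (by linarith)]
  linarith
end
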